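/- For every continuous m-linear form T : c₀ × ⋯ × c₀ → ℂ and every k ∈ {1,…,m}, one has ∑_{i_k=1}^∞ ( ∑_{i_1,…,i_{k-1},i_{k+1},…,i_m=1}^∞ |T(e_{i_1},…,e_{i_m})|² )^{1/2} ≤ (2/√π)^{m-1} ‖T‖. -/

import Mathlib

open Filter Topology

noncomputable section

/-- The space `c₀` of complex null sequences. -/
abbrev c0 : Type := ZeroAtInftyContinuousMap ℕ ℂ

/-- The canonical unit vectors of `c₀`. -/
def e (i : ℕ) : c0 :=
  { toFun := Pi.single i 1
    continuous_toFun := continuous_of_discreteTopology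
    zero_at_infty' := by
      refine Filter.Tendsto.congr' ?_ tendsto_const_nhds
      filter_upwards [Filter.mem_cocompact.mpr ⟨{i}, isCompact_singleton, subset_rfl⟩] with x hx
      simp only [Set.mem_compl_iff, Set.mem_singleton_iff] at hx
      simp [Pi.single_eq_of_ne hx] }

/-- A continuous `m`-linear form on `c₀`. -/
abbrev MForm (m : ℕ) : Type := ContinuousMultilinearMap ℂ (fun _ : Fin m => c0) ℂ

/-- `T` is symmetric. -/
def IsSymmForm {m : ℕ} (T : MForm m) : Prop :=
  ∀ (σ : Equiv.Perm (Fin m)) (v : Fin m → c0), T (fun k => v (σ k)) = T v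

/-- The norm of the `m`-homogeneous polynomial associated to `T`:
`‖P‖ = sup_{x ∈ B_{c₀}} |P x|` where `P x = T (x, …, x)`. -/
def polyNorm {m : ℕ} (T : MForm m) : ℝ :=
  ⨆ x : Metric.closedBall (0 : c0) 1, ‖T (fun _ => (x : c0))‖

/-- Multiplicity of `i` in the index tuple `j`. -/
def mult {m : ℕ} (j : Fin m → ℕ) (i : ℕ) : ℕ :=
  (Finset.univ.filter fun k => j k = i).card

/-- The coefficient of the monomial associated to the (monotone) index tuple `j`
of the `m`-homogeneous polynomial with symmetric multilinear form `T`: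
`c_α(P) = (m!/(α_{i₁}!⋯α_{i_M}!)) ⬝ T(e_{j 1}, …, e_{j m})`. -/
def coeff {m : ℕ} (T : MForm m) (j : Fin m → ℕ) : ℂ :=
  ((Nat.factorial m / ∏ i ∈ Finset.univ.image j, Nat.factorial (mult j i) : ℕ) : ℂ)
    * T (fun k => e (j k))

/-- `ψ_Λ(n)`. -/
def psi {m : ℕ} (Λ : Set (Fin m → ℕ)) (n : ℕ) : ℕ :=
  sSup {c : ℕ | ∃ A : Fin m → Finset ℕ, (∀ i, (A i).card ≤ n) ∧
    c = ({f | ∀ i, f i ∈ A i} ∩ Λ).ncard}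

/-- The combinatorial dimension of `Λ ⊆ ℕ^m`. -/
def combDim {m : ℕ} (Λ : Set (Fin m → ℕ)) : ℝ :=
  Filter.atTop.limsup fun n : ℕ => Real.log (psi Λ n) / Real.log n

end

namespace SK
open MeasureTheory Set

lemma hd_congr {f g : ℝ → ℝ} {a b x : ℝ} (h : HasDerivAt f a x) (h1 : ∀ v, g v = f v) (h2 : b = a) :
    HasDerivAt g b x := by
  have : g = f := funext h1
  rw [this, h2]; exact h

/-- Bessel function J_0. -/
noncomputable def J (u : ℝ) : ℝ := (2 * Real.pi)⁻¹ * ∫ θ in (0:ℝ)..(2 * Real.pi), Real.cos (u * Real.cos θ)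
/-- Bessel function J_1. -/
noncomputable def S (u : ℝ) : ℝ :=
  (2 * Real.pi)⁻¹ * ∫ θ in (0:ℝ)..(2 * Real.pi), Real.cos θ * Real.sin (u * Real.cos θ)

lemma hasDerivAt_J (u : ℝ) : HasDerivAt J (-S u) u := by
  have h := (intervalIntegral.hasDerivAt_integral_of_dominated_loc_of_deriv_le
    (μ := volume) (a := 0) (b := 2 * Real.pi)
    (F := fun u θ => Real.cos (u * Real.cos θ))
    (F' := fun u θ => -(Real.cos θ * Real.sin (u * Real.cos θ)))
    (x₀ := u) (s := univ) (bound := fun _ => 1) univ_mem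
    (Eventually.of_forall fun x => by
      apply Continuous.aestronglyMeasurable; fun_prop)
    (by apply Continuous.intervalIntegrable; fun_prop)
    (by apply Continuous.aestronglyMeasurable; fun_prop)
    (Eventually.of_forall fun t _ x _ => by
      rw [norm_neg, norm_mul]
      exact mul_le_one₀ (Real.abs_cos_le_one _) (norm_nonneg _) (Real.abs_sin_le_one _))
    (by apply Continuous.intervalIntegrable; fun_prop)
    (Eventually.of_forall fun t _ x _ => by
      have := ((hasDerivAt_id x).mul_const (Real.cos t)).cos
      simp only [id] at this
      exact hd_congr this (fun _ => rfl) (by ring))).2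
  have h2 := h.const_mul (2 * Real.pi)⁻¹
  rw [intervalIntegral.integral_neg] at h2
  exact hd_congr h2 (fun _ => rfl) (by unfold S; ring)

lemma S_parts (u : ℝ) : u * ((2 * Real.pi)⁻¹ * ∫ θ in (0:ℝ)..(2 * Real.pi),
    Real.cos θ ^ 2 * Real.cos (u * Real.cos θ)) = u * J u - S u := by
  have h : ∫ θ in (0:ℝ)..(2 * Real.pi), (Real.cos θ * Real.sin (u * Real.cos θ)
      + Real.sin θ * (Real.cos (u * Real.cos θ) * (u * -Real.sin θ))) = 0 := by
    rw [intervalIntegral.integral_eq_sub_of_hasDerivAt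
      (f := fun θ => Real.sin θ * Real.sin (u * Real.cos θ))]
    · simp
    · intro x _
      exact (Real.hasDerivAt_sin x).mul (((Real.hasDerivAt_cos x).const_mul u).sin)
    · apply Continuous.intervalIntegrable; fun_prop
  have e1 : ∀ θ : ℝ, (Real.cos θ * Real.sin (u * Real.cos θ)
      + Real.sin θ * (Real.cos (u * Real.cos θ) * (u * -Real.sin θ)))
      = Real.cos θ * Real.sin (u * Real.cos θ) - u * Real.cos (u * Real.cos θ)
        + u * (Real.cos θ ^ 2 * Real.cos (u * Real.cos θ)) := by
    intro θ
    have := Real.sin_sq_add_cos_sq θ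
    linear_combination (-u * Real.cos (u * Real.cos θ)) * this
  simp_rw [e1] at h
  rw [intervalIntegral.integral_add, intervalIntegral.integral_sub,
    intervalIntegral.integral_const_mul, intervalIntegral.integral_const_mul] at h
  · unfold J S
    linear_combination (2 * Real.pi)⁻¹ * h
  all_goals apply Continuous.intervalIntegrable; fun_prop

lemma hasDerivAt_S (u : ℝ) : HasDerivAt S ((2 * Real.pi)⁻¹ * ∫ θ in (0:ℝ)..(2 * Real.pi),
    Real.cos θ ^ 2 * Real.cos (u * Real.cos θ)) u := by
  have h := (intervalIntegral.hasDerivAt_integral_of_dominated_loc_of_deriv_le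
    (μ := volume) (a := 0) (b := 2 * Real.pi)
    (F := fun u θ => Real.cos θ * Real.sin (u * Real.cos θ))
    (F' := fun u θ => Real.cos θ ^ 2 * Real.cos (u * Real.cos θ))
    (x₀ := u) (s := univ) (bound := fun _ => 1) univ_mem
    (Eventually.of_forall fun x => by
      apply Continuous.aestronglyMeasurable; fun_prop)
    (by apply Continuous.intervalIntegrable; fun_prop)
    (by apply Continuous.aestronglyMeasurable; fun_prop)
    (Eventually.of_forall fun t _ x _ => by
      rw [norm_mul, norm_pow]
      exact mul_le_one₀ (pow_le_one₀ (norm_nonneg _) (Real.abs_cos_le_one _))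
        (norm_nonneg _) (Real.abs_cos_le_one _))
    (by apply Continuous.intervalIntegrable; fun_prop)
    (Eventually.of_forall fun t _ x _ => by
      have := (((hasDerivAt_id x).mul_const (Real.cos t)).sin).const_mul (Real.cos t)
      simp only [id] at this
      exact hd_congr this (fun _ => rfl) (by ring))).2
  exact h.const_mul (2 * Real.pi)⁻¹

lemma hasDerivAt_uS (u : ℝ) : HasDerivAt (fun u => u * S u) (u * J u) u := by
  have h := (hasDerivAt_id u).mul (hasDerivAt_S u)
  simp only [id] at h
  rw [S_parts] at h
  exact hd_congr h (fun _ => rfl) (by ring)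

lemma J_zero : J 0 = 1 := by
  unfold J; simp; field_simp
lemma S_zero : S 0 = 0 := by
  unfold S; simp

lemma continuous_J : Continuous J :=
  continuous_iff_continuousAt.2 fun u => (hasDerivAt_J u).continuousAt
lemma continuous_S : Continuous S :=
  continuous_iff_continuousAt.2 fun u => (hasDerivAt_S u).continuousAt

lemma abs_J_le (u : ℝ) : |J u| ≤ 1 := by
  unfold J
  have := intervalIntegral.norm_integral_le_of_norm_le_const (a := 0) (b := 2 * Real.pi) (C := 1)
    (f := fun θ => Real.cos (u * Real.cos θ)) (fun x _ => Real.abs_cos_le_one _)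
  have hp := Real.pi_pos
  rw [abs_mul, abs_of_pos (by positivity : (0:ℝ) < (2 * Real.pi)⁻¹)]
  rw [Real.norm_eq_abs, sub_zero, abs_of_pos (by positivity : 0 < 2 * Real.pi)] at this
  calc _ ≤ (2 * Real.pi)⁻¹ * (1 * (2 * Real.pi)) := by gcongr
    _ = 1 := by field_simp

/-- comparison lemma -/
lemma le_of_deriv {f g f' g' : ℝ → ℝ} (hf : ∀ u, HasDerivAt f (f' u) u)
    (hg : ∀ u, HasDerivAt g (g' u) u) (h0 : f 0 ≤ g 0) (h : ∀ u, 0 ≤ u → f' u ≤ g' u)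
    (u : ℝ) (hu : 0 ≤ u) : f u ≤ g u := by
  have hm : MonotoneOn (fun x => g x - f x) (Ici 0) := by
    apply monotoneOn_of_hasDerivWithinAt_nonneg (convex_Ici 0) (f' := fun x => g' x - f' x)
    · exact fun x _ => ((hg x).sub (hf x)).continuousAt.continuousWithinAt
    · exact fun x _ => ((hg x).sub (hf x)).hasDerivWithinAt
    · intro x hx
      rw [interior_Ici] at hx
      exact sub_nonneg.2 (h x (le_of_lt hx))
  have := hm (mem_Ici.2 le_rfl) (mem_Ici.2 hu) hu
  simp only at this
  linarith

lemma step_S_upper {p q : ℝ → ℝ} (hp : ∀ u, 0 ≤ u → J u ≤ p u)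
    (hq : ∀ u, HasDerivAt (fun u => u * q u) (u * p u) u) (u : ℝ) (hu : 0 ≤ u) : u * S u ≤ u * q u :=
  le_of_deriv hasDerivAt_uS hq (by simp) (fun u hu => mul_le_mul_of_nonneg_left (hp u hu) hu) u hu

lemma step_S_lower {p q : ℝ → ℝ} (hp : ∀ u, 0 ≤ u → p u ≤ J u)
    (hq : ∀ u, HasDerivAt (fun u => u * q u) (u * p u) u) (u : ℝ) (hu : 0 ≤ u) : u * q u ≤ u * S u :=
  le_of_deriv hq hasDerivAt_uS (by simp) (fun u hu => mul_le_mul_of_nonneg_left (hp u hu) hu) u hu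

lemma div_u {a b : ℝ → ℝ} (h0 : a 0 ≤ b 0) (h : ∀ u, 0 ≤ u → u * a u ≤ u * b u) (u : ℝ) (hu : 0 ≤ u) :
    a u ≤ b u := by
  rcases hu.eq_or_lt with rfl | hu'
  · exact h0
  · exact le_of_mul_le_mul_left (h u hu) hu'

/-- Even Taylor polynomial with signs. -/
noncomputable def T (k : ℕ) (u : ℝ) : ℝ := u ^ (2 * k) / (4 ^ k * (k.factorial : ℝ) ^ 2)
/-- Odd Taylor monomial. -/
noncomputable def V (k : ℕ) (u : ℝ) : ℝ :=
  u ^ (2 * k + 1) / (2 * 4 ^ k * (k.factorial : ℝ) * ((k + 1).factorial : ℝ))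

lemma hasDerivAt_T (k : ℕ) (u : ℝ) : HasDerivAt (T (k + 1)) (V k u) u := by
  unfold T V
  have := (hasDerivAt_pow (2 * (k + 1)) u).div_const (4 ^ (k + 1) * ((k + 1).factorial : ℝ) ^ 2)
  refine hd_congr this (fun _ => rfl) ?_
  have h1 : (k.factorial : ℝ) ≠ 0 := by positivity
  rw [Nat.factorial_succ, show 2 * (k + 1) - 1 = 2 * k + 1 by omega]
  push_cast
  field_simp
  ring

lemma hasDerivAt_uV (k : ℕ) (u : ℝ) : HasDerivAt (fun u => u * V k u) (u * T k u) u := by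
  unfold T V
  have := (hasDerivAt_pow (2 * k + 2) u).div_const
    (2 * 4 ^ k * (k.factorial : ℝ) * ((k + 1).factorial : ℝ))
  have h1 : (k.factorial : ℝ) ≠ 0 := by positivity
  refine hd_congr this (fun u => ?_) ?_
  · ring
  · rw [Nat.factorial_succ, show 2 * k + 2 - 1 = 2 * k + 1 by omega]
    push_cast
    field_simp
    ring

lemma sgn_sq (k : ℕ) : ((-1:ℝ)) ^ k * (-1) ^ k = 1 := by
  rw [← mul_pow]; norm_num

lemma V_zero (k : ℕ) : V k 0 = 0 := by simp [V]
lemma T_zero (k : ℕ) : T (k+1) 0 = 0 := by simp [T]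

lemma alt_bound (k : ℕ) :
    (∀ u, 0 ≤ u → (-1) ^ k * (J u - ∑ j ∈ Finset.range k, (-1) ^ j * T j u) ≤ T k u) ∧
    (∀ u, 0 ≤ u → (-1) ^ k * (S u - ∑ j ∈ Finset.range k, (-1) ^ j * V j u) ≤ V k u) := by
  have key : ∀ k : ℕ, (∀ u, 0 ≤ u → (-1) ^ k * (J u - ∑ j ∈ Finset.range k, (-1) ^ j * T j u) ≤ T k u) →
    (∀ u, 0 ≤ u → (-1) ^ k * (S u - ∑ j ∈ Finset.range k, (-1) ^ j * V j u) ≤ V k u) := by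
    intro k hk
    apply div_u
    · simp [S_zero, V_zero]
    apply le_of_deriv (f' := fun u => u * ((-1) ^ k * (J u - ∑ j ∈ Finset.range k, (-1) ^ j * T j u)))
      (g' := fun u => u * T k u)
    · intro u
      have h1 : HasDerivAt (fun u => ∑ j ∈ Finset.range k, (-1) ^ j * (u * V j u))
        (∑ j ∈ Finset.range k, (-1) ^ j * (u * T j u)) u :=
        HasDerivAt.fun_sum fun j _ => (hasDerivAt_uV j u).const_mul _
      have h2 := ((hasDerivAt_uS u).sub h1).const_mul ((-1) ^ k)
      refine hd_congr h2 (fun v => ?_) ?_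
      · simp only [Pi.sub_apply]
        rw [show ∑ j ∈ Finset.range k, (-1) ^ j * (v * V j v) = v * ∑ j ∈ Finset.range k, (-1) ^ j * V j v by
          rw [Finset.mul_sum]; exact Finset.sum_congr rfl fun j _ => by ring]
        ring
      · rw [show ∑ j ∈ Finset.range k, (-1) ^ j * (u * T j u) = u * ∑ j ∈ Finset.range k, (-1) ^ j * T j u by
          rw [Finset.mul_sum]; exact Finset.sum_congr rfl fun j _ => by ring]
        ring
    · exact hasDerivAt_uV k
    · simp
    · exact fun u hu => mul_le_mul_of_nonneg_left (hk u hu) hu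
  induction k with
  | zero =>
    have : ∀ u, 0 ≤ u → (-1) ^ 0 * (J u - ∑ j ∈ Finset.range 0, (-1) ^ j * T j u) ≤ T 0 u := by
      intro u _
      simp [T]
      exact (abs_le.1 (abs_J_le u)).2
    exact ⟨this, key 0 this⟩
  | succ k ih =>
    have : ∀ u, 0 ≤ u → (-1) ^ (k+1) * (J u - ∑ j ∈ Finset.range (k+1), (-1) ^ j * T j u) ≤ T (k+1) u := by
      apply le_of_deriv (f' := fun u => (-1) ^ k * (S u - ∑ j ∈ Finset.range k, (-1) ^ j * V j u))
        (g' := fun u => V k u)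
      · intro u
        have h1 : HasDerivAt (fun u => ∑ j ∈ Finset.range k, (-1) ^ (j+1) * (T (j+1) u))
          (∑ j ∈ Finset.range k, (-1) ^ (j+1) * (V j u)) u :=
          HasDerivAt.fun_sum fun j _ => (hasDerivAt_T j u).const_mul _
        have h2 := (((hasDerivAt_J u).sub h1).sub_const (T 0 u)).const_mul ((-1) ^ (k+1))
        refine hd_congr h2 (fun v => ?_) ?_
        · simp only [Pi.sub_apply]
          rw [Finset.sum_range_succ']
          simp [T]
          ring
        · simp_rw [pow_succ, mul_neg_one, neg_mul, Finset.sum_neg_distrib]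
          ring
      · exact hasDerivAt_T k
      · rw [Finset.sum_range_succ']
        simp [T_zero, J_zero]
        simp [T]
      · exact ih.2
    exact ⟨this, key _ this⟩

end SK

namespace SK
open MeasureTheory Set

lemma J_ge_one (u : ℝ) (hu : 0 ≤ u) : 1 - u ^ 2 / 4 ≤ J u := by
  have h := (alt_bound 1).1 u hu
  simp [Finset.sum_range_succ, T, Nat.factorial] at h
  linarith

lemma J_le_two (u : ℝ) (hu : 0 ≤ u) : J u ≤ 1 - u ^ 2 / 4 + u ^ 4 / 64 := by
  have h := (alt_bound 2).1 u hu
  simp [Finset.sum_range_succ, T, Nat.factorial] at h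
  linarith

lemma J_ge_five : -(394/1000) ≤ J (36/10) := by
  have h := (alt_bound 5).1 (36/10) (by norm_num)
  simp [Finset.sum_range_succ, T, Nat.factorial] at h
  norm_num at h
  linarith

lemma S_ge_three (u : ℝ) (hu : 0 ≤ u) (h2 : u ≤ 36/10) : 0 ≤ S u := by
  have h := (alt_bound 3).2 u hu
  simp [Finset.sum_range_succ, V, Nat.factorial] at h
  have hx : 0 ≤ 1 - (u^2/4) / 2 + (u^2/4)^2/12 - (u^2/4)^3/144 := by
    have h0 : 0 ≤ u^2/4 := by positivity
    have h1 : u^2/4 ≤ 324/100 := by nlinarith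
    generalize u^2/4 = x at h0 h1
    nlinarith [mul_nonneg (sub_nonneg.2 h1) (sq_nonneg (x - 4)), mul_nonneg (sub_nonneg.2 h1) h0, sq_nonneg (x-324/100)]
  have := mul_nonneg hu hx
  nlinarith

lemma S_le_four : S (36/10) ≤ 1025/10000 := by
  have h := (alt_bound 4).2 (36/10) (by norm_num)
  simp [Finset.sum_range_succ, V, Nat.factorial] at h
  norm_num at h
  linarith

lemma J_neg (u : ℝ) : J (-u) = J u := by
  unfold J; simp

lemma J_anti (u v : ℝ) (hu : 0 ≤ u) (huv : u ≤ v) (hv : v ≤ 36/10) : J v ≤ J u := by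
  have : AntitoneOn J (Icc 0 (36/10)) := by
    apply antitoneOn_of_hasDerivWithinAt_nonpos (convex_Icc _ _) (f' := fun x => -S x)
      continuous_J.continuousOn
    · exact fun x _ => (hasDerivAt_J x).hasDerivWithinAt
    · intro x hx
      rw [interior_Icc] at hx
      have := S_ge_three x hx.1.le hx.2.le
      simpa using this
  exact this ⟨hu, huv.trans hv⟩ ⟨hu.trans huv, hv⟩ huv

lemma energy (u : ℝ) (hu : 36/10 ≤ u) : J u ^ 2 + S u ^ 2 ≤ J (36/10) ^ 2 + S (36/10) ^ 2 := by
  have : AntitoneOn (fun x => J x ^ 2 + S x ^ 2) (Ici (36/10)) := by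
    apply antitoneOn_of_hasDerivWithinAt_nonpos (convex_Ici _)
      (f' := fun x => 2 * J x * (-S x) + 2 * S x * ((2 * Real.pi)⁻¹ * ∫ θ in (0:ℝ)..(2 * Real.pi),
    Real.cos θ ^ 2 * Real.cos (x * Real.cos θ)))
    · exact ((continuous_J.pow 2).add (continuous_S.pow 2)).continuousOn
    · intro x _
      have := ((hasDerivAt_J x).pow 2).add ((hasDerivAt_S x).pow 2)
      exact (hd_congr this (fun _ => rfl) (by simp)).hasDerivWithinAt
    · intro x hx
      rw [interior_Ici] at hx
      have hx0 : 0 < x := lt_trans (by norm_num) hx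
      have h := S_parts x
      set I := ((2 * Real.pi)⁻¹ * ∫ θ in (0:ℝ)..(2 * Real.pi),
        Real.cos θ ^ 2 * Real.cos (x * Real.cos θ))
      have h2 : x * (2 * J x * (-S x) + 2 * S x * I) = - 2 * S x ^ 2 := by
        linear_combination 2 * S x * h
      by_contra hc
      push Not at hc
      have := mul_pos hx0 hc
      nlinarith [sq_nonneg (S x)]
  exact this (mem_Ici.2 le_rfl) (mem_Ici.2 hu) hu

lemma exp_ge_cubic (x : ℝ) (hx : 0 ≤ x) : 1 - x + x^2/2 - x^3/6 ≤ Real.exp (-x) := by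
  have h1 : ∀ x, 0 ≤ x → 1 - x ≤ Real.exp (-x) := fun x _ => by
    have := Real.add_one_le_exp (-x); linarith
  have d : ∀ u : ℝ, HasDerivAt (fun u => Real.exp (-u)) (-Real.exp (-u)) u := fun u => by
    have := (hasDerivAt_neg u).exp
    exact hd_congr this (fun _ => rfl) (by ring)
  have h2 : ∀ x, 0 ≤ x → Real.exp (-x) ≤ 1 - x + x^2/2 := by
    apply le_of_deriv (f' := fun u => -Real.exp (-u)) (g' := fun u => -1 + u)
    · exact d
    · intro u
      have := (((hasDerivAt_const u (1:ℝ)).sub (hasDerivAt_id u)).add ((hasDerivAt_pow 2 u).div_const 2))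
      exact hd_congr this (fun _ => rfl) (by simp)
    · simp
    · intro u hu
      have := h1 u hu; linarith
  have h3 : ∀ x, 0 ≤ x → 1 - x + x^2/2 - x^3/6 ≤ Real.exp (-x) := by
    apply le_of_deriv (g' := fun u => -Real.exp (-u)) (f' := fun u => -1 + u - u^2/2)
    · intro u
      have := ((((hasDerivAt_const u (1:ℝ)).sub (hasDerivAt_id u)).add ((hasDerivAt_pow 2 u).div_const 2))).sub ((hasDerivAt_pow 3 u).div_const 6)
      exact hd_congr this (fun _ => rfl) (by simp; ring)
    · exact d
    · simp
    · intro u hu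
      have := h2 u hu; linarith
  exact h3 x hx

/-- threshold value -/
noncomputable def y0 : ℝ := Real.exp (-((189/100)^2/4))

lemma y0_sq : (1660/10000 : ℝ) ≤ y0 ^ 2 := by
  unfold y0
  rw [← Real.exp_nat_mul, ← neg_neg (((2:ℕ):ℝ) * _), Real.exp_neg]
  have h1 : Real.exp (-(((2:ℕ):ℝ) * -((189/100)^2/4))) ≤ 60/10 := by
    have h2 : (-(((2:ℕ):ℝ) * -((189/100)^2/4)) : ℝ) = 2 + (-(21395/100000)) := by norm_num
    rw [h2, Real.exp_add]
    have h3 : Real.exp 2 ≤ 7.38906 := by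
      have := Real.exp_one_lt_d9
      have h4 : Real.exp 2 = Real.exp 1 ^ 2 := by rw [← Real.exp_nat_mul]; norm_num
      rw [h4]
      have := Real.exp_pos 1
      nlinarith
    have h5 : Real.exp (-(21395/100000)) ≤ 0.8075 := by
      rw [Real.exp_neg]
      have : 1 + 21395/100000 + (21395/100000)^2/2 + (21395/100000:ℝ)^3/6 ≤ Real.exp (21395/100000) := by
        have := Real.sum_le_exp_of_nonneg (x := 21395/100000) (by norm_num) 4
        simp [Finset.sum_range_succ, Nat.factorial] at this
        norm_num at this ⊢
        linarith
      rw [inv_le_comm₀ (Real.exp_pos _) (by norm_num)]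
      norm_num at this ⊢
      linarith
    calc _ ≤ 7.38906 * 0.8075 := mul_le_mul h3 h5 (Real.exp_pos _).le (by norm_num)
      _ ≤ _ := by norm_num
  rw [le_inv_comm₀ (by norm_num) (Real.exp_pos _)]
  norm_num at h1 ⊢
  linarith

lemma y0_sq_le : y0 ^ 2 ≤ 16800/100000 := by
  unfold y0
  rw [← Real.exp_nat_mul, ← neg_neg (((2:ℕ):ℝ) * _), Real.exp_neg]
  rw [inv_le_comm₀ (Real.exp_pos _) (by norm_num)]
  have h2 : (-(((2:ℕ):ℝ) * -((189/100)^2/4)) : ℝ) = 2 + (-(21395/100000)) := by norm_num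
  rw [h2, Real.exp_add]
  have h3 : 7.38905 ≤ Real.exp 2 := by
    have := Real.exp_one_gt_d9
    have h4 : Real.exp 2 = Real.exp 1 ^ 2 := by rw [← Real.exp_nat_mul]; norm_num
    rw [h4]
    nlinarith
  have h5 : 0.8073 ≤ Real.exp (-(21395/100000)) := by
    have := exp_ge_cubic (21395/100000) (by norm_num)
    norm_num at this ⊢
    linarith
  have := Real.exp_pos 2
  norm_num at h3 h5 ⊢
  nlinarith

lemma J_small (u : ℝ) (hu : 0 ≤ u) (h : u ≤ 189/100) : |J u| ≤ Real.exp (-(u^2/4)) := by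
  have h1 := J_ge_one u hu
  have h2 := J_le_two u hu
  have h3 := exp_ge_cubic (u^2/4) (by positivity)
  have hx : u^2/4 ≤ 9/10 := by nlinarith
  have h0 : 0 ≤ u^2/4 := by positivity
  rw [abs_of_nonneg (by linarith)]
  refine h2.trans (le_trans ?_ h3)
  rw [show u^4/64 = (u^2/4)^2/4 by ring]
  generalize u^2/4 = x at hx h0
  nlinarith [mul_nonneg (sq_nonneg x) (by linarith : 0 ≤ 3/2 - x)]

lemma J_large (u : ℝ) (h : 189/100 ≤ u) : |J u| ≤ y0 := by
  have hy := y0_sq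
  have hy0 : 0 < y0 := Real.exp_pos _
  have hy1 : 0.407 ≤ y0 := by norm_num; nlinarith
  rcases le_total u (36/10) with h2 | h2
  · rw [abs_le]
    constructor
    · have := J_anti u (36/10) (by linarith) h2 le_rfl
      have := J_ge_five
      norm_num at hy1
      linarith
    · have := J_anti (189/100) u (by norm_num) h h2
      have h4 := J_small (189/100) (by norm_num) le_rfl
      exact this.trans ((le_abs_self _).trans h4)
  · have h1 := energy u h2
    have h3 := J_ge_five
    have h4 := S_le_four
    have h5 := S_ge_three (36/10) (by norm_num) le_rfl
    have h6 : J (36/10) ≤ 0.394 := by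
      have := J_anti 2 (36/10) (by norm_num) (by norm_num) le_rfl
      have := J_le_two 2 (by norm_num)
      norm_num at this ⊢
      linarith
    norm_num at h6
    refine abs_le_of_sq_le_sq ?_ hy0.le
    nlinarith [sq_nonneg (S u)]

end SK

namespace SK
open MeasureTheory Set

lemma int_div_sq {h : ℝ → ℝ} (hm : Measurable h) (C D : ℝ) (h1 : ∀ u, 0 < u → |h u| ≤ C * u ^ 2)
    (h2 : ∀ u, 0 < u → |h u| ≤ D) : IntegrableOn (fun u => h u / u ^ 2) (Ioi 0) := by
  have hm' : Measurable (fun u => h u / u ^ 2) := by fun_prop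
  rw [← Ioc_union_Ioi_eq_Ioi (zero_le_one (α := ℝ))]
  apply IntegrableOn.union
  · refine Measure.integrableOn_of_bounded (M := C) (by simp) hm'.aestronglyMeasurable ?_
    refine (ae_restrict_iff' measurableSet_Ioc).2 (Eventually.of_forall fun u hu => ?_)
    have hu0 : 0 < u := hu.1
    rw [norm_div, Real.norm_eq_abs, Real.norm_eq_abs, abs_of_pos (by positivity : 0 < u^2),
      div_le_iff₀ (by positivity)]
    exact h1 u hu0
  · have hi : IntegrableOn (fun u : ℝ => D * u ^ (-2:ℝ)) (Ioi 1) :=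
      (integrableOn_Ioi_rpow_of_lt (by norm_num) one_pos).const_mul D
    refine Integrable.mono' hi hm'.aestronglyMeasurable ?_
    refine (ae_restrict_iff' measurableSet_Ioi).2 (Eventually.of_forall fun u hu => ?_)
    have hu0 : 0 < u := lt_trans one_pos hu
    rw [norm_div, Real.norm_eq_abs, Real.norm_eq_abs, abs_of_pos (by positivity : 0 < u^2),
      Real.rpow_neg hu0.le, div_eq_mul_inv]
    norm_cast
    gcongr
    exact h2 u hu0

lemma gauss_integrable (α : ℝ) (hα : 0 ≤ α) :
    IntegrableOn (fun u => (1 - Real.exp (-(α * u ^ 2))) / u ^ 2) (Ioi 0) := by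
  apply int_div_sq (by fun_prop) α 1
  · intro u hu
    have := Real.add_one_le_exp (-(α * u^2))
    have : Real.exp (-(α * u^2)) ≤ 1 := Real.exp_le_one_iff.2 (by have := mul_nonneg hα (sq_nonneg u); linarith)
    rw [abs_of_nonneg (by linarith)]; linarith
  · intro u hu
    have := Real.exp_pos (-(α * u^2))
    have : Real.exp (-(α * u^2)) ≤ 1 := Real.exp_le_one_iff.2 (by have := mul_nonneg hα (sq_nonneg u); linarith)
    rw [abs_of_nonneg (by linarith)]; linarith

lemma gauss_integral (α : ℝ) (hα : 0 < α) :
    ∫ u in Ioi (0:ℝ), (1 - Real.exp (-(α * u ^ 2))) / u ^ 2 = Real.sqrt (Real.pi * α) := by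
  have hi := gauss_integrable α hα.le
  have hg : IntegrableOn (fun u : ℝ => Real.exp (-α * u ^ 2)) (Ioi 0) :=
    (integrable_exp_neg_mul_sq hα).integrableOn
  have key : ∫ u in Ioi (0:ℝ), ((1 - Real.exp (-(α * u ^ 2))) / u ^ 2
      - 2 * α * Real.exp (-α * u ^ 2)) = 0 - (Real.exp (-(α * (0:ℝ) ^ 2)) - 1) / 0 := by
    apply integral_Ioi_of_hasDerivAt_of_tendsto (f := fun u => (Real.exp (-(α * u ^ 2)) - 1) / u)
    · have : ∀ u : ℝ, |(Real.exp (-(α * u ^ 2)) - 1) / u| ≤ α * |u| := by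
        intro u
        rcases eq_or_ne u 0 with rfl | hu
        · simp
        have h1 := Real.add_one_le_exp (-(α * u^2))
        have h2 : Real.exp (-(α * u^2)) ≤ 1 :=
          Real.exp_le_one_iff.2 (by have := mul_nonneg hα.le (sq_nonneg u); linarith)
        have hu' := abs_pos.2 hu
        rw [abs_div, div_le_iff₀ hu', abs_of_nonpos (by linarith)]
        have : |u| * |u| = u^2 := by rw [← sq, sq_abs]
        nlinarith
      apply ContinuousAt.continuousWithinAt
      unfold ContinuousAt
      simp only [div_zero]
      refine squeeze_zero_norm (a := fun u => α * |u|) this ?_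
      have : Continuous (fun u : ℝ => α * |u|) := by fun_prop
      simpa using this.tendsto 0
    · intro u hu
      have hu0 : u ≠ 0 := (ne_of_gt hu)
      have := (((((hasDerivAt_pow 2 u).const_mul α).neg).exp).sub_const 1).div (hasDerivAt_id u) hu0
      refine hd_congr this (fun _ => rfl) ?_
      simp
      field_simp
      ring
    · exact hi.sub (hg.const_mul _)
    · have : ∀ u : ℝ, 0 < u → |(Real.exp (-(α * u ^ 2)) - 1) / u| ≤ u⁻¹ := by
        intro u hu
        have h1 := Real.exp_pos (-(α * u^2))
        have h2 : Real.exp (-(α * u^2)) ≤ 1 :=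
          Real.exp_le_one_iff.2 (by have := mul_nonneg hα.le (sq_nonneg u); linarith)
        rw [abs_div, abs_of_pos hu, abs_of_nonpos (by linarith), inv_eq_one_div]
        gcongr
        linarith
      refine squeeze_zero_norm' (a := fun u => u⁻¹) ?_ tendsto_inv_atTop_zero
      filter_upwards [eventually_gt_atTop 0] with u hu
      exact this u hu
  rw [integral_sub hi (hg.const_mul _), integral_const_mul, integral_gaussian_Ioi] at key
  simp only [div_zero, sub_zero] at key
  have h1 : Real.sqrt (Real.pi * α) = α * Real.sqrt (Real.pi / α) := by
    rw [show Real.pi * α = α^2 * (Real.pi / α) by field_simp, Real.sqrt_mul (by positivity),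
      Real.sqrt_sq hα.le]
  rw [h1]; linarith

/-- the constant -/
noncomputable def C0 : ℝ := ∫ t in Ioi (0:ℝ), (1 - Real.cos t) / t ^ 2

lemma cos_integrable (x : ℝ) : IntegrableOn (fun t => (1 - Real.cos (t * x)) / t ^ 2) (Ioi 0) := by
  apply int_div_sq (by fun_prop) (x^2/2) 2
  · intro u hu
    have := Real.one_sub_sq_div_two_le_cos (x := u * x)
    have h2 := Real.cos_le_one (u * x)
    rw [abs_of_nonneg (by linarith)]
    linarith
  · intro u hu
    have := Real.neg_one_le_cos (u * x)
    have h2 := Real.cos_le_one (u * x)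
    rw [abs_of_nonneg (by linarith)]
    linarith

lemma cos_integral (x : ℝ) : ∫ t in Ioi (0:ℝ), (1 - Real.cos (t * x)) / t ^ 2 = C0 * |x| := by
  rcases eq_or_ne x 0 with rfl | hx
  · simp
  have hx' := abs_pos.2 hx
  have h := integral_comp_mul_left_Ioi (fun t => (1 - Real.cos t) / t ^ 2) 0 hx'
  simp only [mul_zero, smul_eq_mul] at h
  have e : ∀ t : ℝ, (1 - Real.cos (t * x)) / t ^ 2 = x^2 * ((1 - Real.cos (|x| * t)) / (|x| * t) ^ 2) := by
    intro t
    have h1 : Real.cos (|x| * t) = Real.cos (t * x) := by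
      rcases abs_choice x with h | h <;> rw [h]
      · rw [mul_comm]
      · rw [neg_mul, Real.cos_neg, mul_comm]
    rw [h1, mul_pow, sq_abs]
    rcases eq_or_ne t 0 with rfl | ht
    · simp
    field_simp
  simp_rw [e]
  rw [integral_const_mul, h, C0]
  have : x^2 = |x| * |x| := by rw [← sq, sq_abs]
  rw [this]
  field_simp

lemma C0_nonneg : 0 ≤ C0 := by
  apply setIntegral_nonneg measurableSet_Ioi
  intro t _
  have := Real.cos_le_one t
  have : 0 ≤ 1 - Real.cos t := by linarith
  positivity

lemma fubini_cos {Ω : Type*} [MeasurableSpace Ω] (μ : Measure Ω) [IsProbabilityMeasure μ]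
    (f : Ω → ℝ) (hf : Measurable f) (hi : Integrable f μ) :
    C0 * ∫ ω, |f ω| ∂μ = ∫ t in Ioi (0:ℝ), (1 - ∫ ω, Real.cos (t * f ω) ∂μ) / t ^ 2 := by
  have hint : Integrable (fun p : Ω × ℝ => (1 - Real.cos (p.2 * f p.1)) / p.2 ^ 2)
      (μ.prod (volume.restrict (Ioi 0))) := by
    have hmeas : Measurable (fun p : Ω × ℝ => (1 - Real.cos (p.2 * f p.1)) / p.2 ^ 2) := by fun_prop
    rw [integrable_prod_iff hmeas.aestronglyMeasurable]
    refine ⟨Eventually.of_forall fun ω => cos_integrable (f ω), ?_⟩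
    have e : ∀ ω, ∫ t in Ioi (0:ℝ), ‖(1 - Real.cos (t * f ω)) / t ^ 2‖ = C0 * |f ω| := by
      intro ω
      rw [← cos_integral]
      congr 1; ext t
      apply Real.norm_of_nonneg
      have := Real.cos_le_one (t * f ω)
      have : 0 ≤ 1 - Real.cos (t * f ω) := by linarith
      positivity
    simp_rw [e]
    exact hi.abs.const_mul _
  have h := integral_integral_swap (f := fun ω t => (1 - Real.cos (t * f ω)) / t ^ 2) hint
  simp_rw [cos_integral, integral_const_mul] at h
  rw [h]
  congr 1; ext t
  rw [integral_div, integral_sub (integrable_const _), integral_const]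
  · simp
  · refine Integrable.of_bound (C := 1) ?_ (Eventually.of_forall fun ω => Real.abs_cos_le_one _)
    apply Measurable.aestronglyMeasurable; fun_prop

open ProbabilityTheory in
lemma C0_eq : C0 = Real.pi / 2 := by
  have hid : Integrable (fun x : ℝ => x) (gaussianReal 0 1) := by
    have := (memLp_id_gaussianReal (μ := 0) (v := 1) 1)
    have h2 : MemLp (id : ℝ → ℝ) 1 (gaussianReal 0 1) := by simpa using this
    exact memLp_one_iff_integrable.1 h2
  have h := fubini_cos (gaussianReal 0 1) (fun x => x) measurable_id hid
  have e1 : ∀ t : ℝ, ∫ x, Real.cos (t * x) ∂(gaussianReal 0 1) = Real.exp (-(1/2 * t^2)) := by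
    intro t
    have h1 := charFun_gaussianReal (μ := 0) (v := 1) t
    rw [charFun_apply_real] at h1
    have h2 := congrArg Complex.re h1
    have h3 : Integrable (fun x : ℝ => Complex.exp (t * x * Complex.I)) (gaussianReal 0 1) := by
      refine Integrable.of_bound (C := 1) ?_ (Eventually.of_forall fun ω => ?_)
      · apply Continuous.aestronglyMeasurable; fun_prop
      · rw [← Complex.ofReal_mul, Complex.norm_exp_ofReal_mul_I]
    have h4 := integral_re h3
    simp only [RCLike.re_to_complex] at h4
    rw [h2] at h4
    have h5 : ∀ x : ℝ, (Complex.exp (t * x * Complex.I)).re = Real.cos (t * x) := by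
      intro x
      rw [← Complex.ofReal_mul, Complex.exp_ofReal_mul_I_re]
    simp_rw [h5] at h4
    rw [h4]
    have : (t * ((0:ℝ):ℂ) * Complex.I - ((1:NNReal):ℝ) * t ^ 2 / 2 : ℂ) = ((-(1/2*t^2) : ℝ) : ℂ) := by
      push_cast; ring
    rw [this, Complex.exp_ofReal_re]
  simp_rw [e1] at h
  rw [gauss_integral _ (by norm_num)] at h
  have e2 : ∫ x, |x| ∂(gaussianReal 0 1) = (Real.sqrt (2 * Real.pi))⁻¹ * 2 := by
    rw [integral_gaussianReal_eq_integral_smul one_ne_zero]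
    simp only [gaussianPDFReal, smul_eq_mul, sub_zero]
    have e3 : ∀ x : ℝ, (Real.sqrt (2 * Real.pi * (1:NNReal)))⁻¹ * Real.exp (-x^2 / (2 * (1:NNReal))) * |x|
       = (fun y => (Real.sqrt (2 * Real.pi))⁻¹ * (y ^ (1:ℝ) * Real.exp (-(1/2) * y ^ (2:ℝ)))) |x| := by
      intro x
      simp
      ring_nf
    simp_rw [e3]
    rw [integral_comp_abs (f := fun y => (Real.sqrt (2 * Real.pi))⁻¹ * (y ^ (1:ℝ) * Real.exp (-(1/2) * y ^ (2:ℝ)))),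
      integral_const_mul, integral_rpow_mul_exp_neg_mul_rpow (by norm_num) (by norm_num) (by norm_num)]
    norm_num
    ring
  rw [e2] at h
  have hs : Real.sqrt (Real.pi * (1/2)) * Real.sqrt (2 * Real.pi) = Real.pi := by
    rw [← Real.sqrt_mul (by positivity), show Real.pi * (1/2) * (2 * Real.pi) = Real.pi^2 by ring,
      Real.sqrt_sq Real.pi_pos.le]
  have hp : 0 < Real.sqrt (2 * Real.pi) := Real.sqrt_pos.2 (by positivity)
  have h' : C0 * 2 = Real.sqrt (Real.pi * (1/2)) * Real.sqrt (2 * Real.pi) := by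
    rw [← h]; field_simp
  rw [hs] at h'
  linarith

lemma tail_bound : IntegrableOn (fun u : ℝ => Real.exp (-(1/2 * u^2)) / u^2) (Ioi (189/100)) ∧
    ∫ u in Ioi (189/100 : ℝ), Real.exp (-(1/2 * u^2)) / u^2 ≤ 195/10000 := by
  set g : ℝ → ℝ := fun u => -(Real.exp (-(1/2 * u^2)) / (u * (1 + u^2))) with hg
  set g' : ℝ → ℝ := fun u => Real.exp (-(1/2 * u^2)) * (u^4 + 4 * u^2 + 1) / (u * (1 + u^2))^2 with hg'
  have hd : ∀ u ∈ Ici (189/100 : ℝ), HasDerivAt g (g' u) u := by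
    intro u hu
    have hu0 : 0 < u := lt_of_lt_of_le (by norm_num) (mem_Ici.1 hu)
    have h1 := (((hasDerivAt_pow 2 u).const_mul (1/2)).neg).exp
    have h2 := (hasDerivAt_id u).mul ((hasDerivAt_pow 2 u).const_add 1)
    have h0 : u * (1 + u^2) ≠ 0 := by positivity
    have := (h1.div h2 (by exact h0)).neg
    refine hd_congr this (fun _ => rfl) ?_
    simp [hg']
    field_simp
    ring
  have hpos : ∀ u ∈ Ioi (189/100 : ℝ), 0 ≤ g' u := fun u _ => by simp only [hg']; positivity
  have hlim : Tendsto g atTop (𝓝 0) := by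
    refine squeeze_zero_norm' (a := fun u => u⁻¹) ?_ tendsto_inv_atTop_zero
    filter_upwards [eventually_gt_atTop 0] with u hu
    simp only [hg]
    rw [norm_neg, Real.norm_of_nonneg (by positivity), inv_eq_one_div]
    have : Real.exp (-(1/2 * u^2)) ≤ 1 := Real.exp_le_one_iff.2 (by nlinarith [sq_nonneg u])
    apply div_le_div₀ zero_le_one this hu
    nlinarith [sq_nonneg u]
  have hint := integrableOn_Ioi_deriv_of_nonneg' hd hpos hlim
  have hval := integral_Ioi_of_hasDerivAt_of_nonneg' hd hpos hlim
  have hle : ∀ u ∈ Ioi (189/100 : ℝ), Real.exp (-(1/2 * u^2)) / u^2 ≤ g' u := by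
    intro u hu
    have hu0 : 0 < u := lt_trans (by norm_num) hu
    simp only [hg']
    rw [div_le_div_iff₀ (by positivity) (by positivity), mul_assoc]
    gcongr
    have : 0 < u^2 := by positivity
    nlinarith [mul_pos this this]
  have hi : IntegrableOn (fun u : ℝ => Real.exp (-(1/2 * u^2)) / u^2) (Ioi (189/100)) := by
    refine Integrable.mono' hint (Measurable.aestronglyMeasurable (by fun_prop)) ?_
    refine (ae_restrict_iff' measurableSet_Ioi).2 (Eventually.of_forall fun u hu => ?_)
    rw [Real.norm_of_nonneg (by positivity)]
    exact hle u hu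
  refine ⟨hi, (setIntegral_mono_on hi hint measurableSet_Ioi hle).trans ?_⟩
  rw [hval]
  simp only [hg]
  have hy := y0_sq_le
  have : y0^2 = Real.exp (-(1/2 * (189/100)^2)) := by
    unfold y0; rw [← Real.exp_nat_mul]; congr 1; norm_num
  rw [← this]
  norm_num at hy ⊢
  linarith

end SK

namespace SK
open MeasureTheory Set

/-- uniform probability on the circle parameter. -/
noncomputable def nu : Measure ℝ := ENNReal.ofReal (2 * Real.pi)⁻¹ • volume.restrict (Ioc 0 (2 * Real.pi))

instance : IsProbabilityMeasure nu := by
  constructor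
  simp only [nu, Measure.smul_apply, Measure.restrict_apply MeasurableSet.univ, univ_inter,
    Real.volume_Ioc, smul_eq_mul, sub_zero]
  rw [← ENNReal.ofReal_mul (by positivity), inv_mul_cancel₀ (by positivity), ENNReal.ofReal_one]

/-- product of uniform probabilities. -/
noncomputable def mu (n : ℕ) : Measure (Fin n → ℝ) := Measure.pi (fun _ => nu)

instance (n : ℕ) : IsProbabilityMeasure (mu n) := by unfold mu; infer_instance

lemma nu_integral {E : Type*} [NormedAddCommGroup E] [NormedSpace ℝ E] (f : ℝ → E) :
    ∫ θ, f θ ∂nu = (2 * Real.pi)⁻¹ • ∫ θ in (0:ℝ)..(2 * Real.pi), f θ := by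
  rw [nu, integral_smul_measure, intervalIntegral.integral_of_le (by positivity),
    ENNReal.toReal_ofReal (by positivity)]

lemma nu_shift {E : Type*} [NormedAddCommGroup E] [NormedSpace ℝ E] (f : ℝ → E)
    (hf : Function.Periodic f (2 * Real.pi)) (α : ℝ) :
    ∫ θ, f (θ + α) ∂nu = ∫ θ, f θ ∂nu := by
  rw [nu_integral, nu_integral, intervalIntegral.integral_comp_add_right]
  have := hf.intervalIntegral_add_eq α 0
  rw [zero_add] at this
  rw [zero_add, add_comm, this]

/-- unimodular exponential -/
noncomputable def zz (θ : ℝ) : ℂ := Complex.exp (θ * Complex.I)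

lemma continuous_zz : Continuous zz := by unfold zz; fun_prop
lemma norm_zz (θ : ℝ) : ‖zz θ‖ = 1 := Complex.norm_exp_ofReal_mul_I θ
lemma zz_add (a b : ℝ) : zz (a + b) = zz a * zz b := by
  unfold zz; rw [← Complex.exp_add]; push_cast; ring_nf
lemma zz_periodic : Function.Periodic zz (2 * Real.pi) := by
  intro x
  have h : zz (2 * Real.pi) = 1 := by unfold zz; push_cast; exact Complex.exp_two_pi_mul_I
  rw [zz_add, h, mul_one]
lemma zz_re (θ : ℝ) : (zz θ).re = Real.cos θ := Complex.exp_ofReal_mul_I_re θ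
lemma zz_im (θ : ℝ) : (zz θ).im = Real.sin θ := Complex.exp_ofReal_mul_I_im θ
lemma polar (w : ℂ) : w = ‖w‖ * zz w.arg := (Complex.norm_mul_exp_arg_mul_I w).symm

lemma nu_rot {E : Type*} [NormedAddCommGroup E] [NormedSpace ℝ E] (F : ℂ → E) (w : ℂ) :
    ∫ θ, F (w * zz θ) ∂nu = ∫ θ, F (‖w‖ * zz θ) ∂nu := by
  rw [← nu_shift (fun θ => F (‖w‖ * zz θ)) (fun θ => by simp only [zz_periodic θ]) w.arg]
  congr 1; ext θ
  conv_lhs => rw [polar w]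
  rw [zz_add]; congr 1; ring

lemma cexp_I (x : ℝ) : Complex.exp (x * Complex.I) = zz x := rfl

lemma char_one (t : ℝ) (w : ℂ) : ∫ θ, zz (t * (w * zz θ).re) ∂nu = (J (t * ‖w‖) : ℂ) := by
  rw [nu_rot (fun v => zz (t * v.re)) w]
  simp only [Complex.re_ofReal_mul, zz_re, ← mul_assoc]
  set r := t * ‖w‖
  have hc : Continuous (fun θ => zz (r * Real.cos θ)) := continuous_zz.comp (by fun_prop)
  have hint : Integrable (fun θ => zz (r * Real.cos θ)) nu :=
    Integrable.of_bound (C := 1) hc.aestronglyMeasurable (Eventually.of_forall fun θ => (norm_zz _).le)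
  have hre := integral_re hint
  have him := integral_im hint
  simp only [RCLike.re_to_complex, RCLike.im_to_complex, zz_re, zz_im] at hre him
  have h0 : ∫ θ, Real.sin (r * Real.cos θ) ∂nu = 0 := by
    have := nu_shift (fun θ => Real.sin (r * Real.cos θ)) (fun θ => by simp) Real.pi
    simp only [Real.cos_add_pi, mul_neg, Real.sin_neg, integral_neg] at this
    linarith
  apply Complex.ext
  · rw [← hre, nu_integral, Complex.ofReal_re]; rfl
  · rw [← him, h0, Complex.ofReal_im]

/-- Steinhaus sum -/
noncomputable def X {n : ℕ} (a : Fin n → ℂ) (θ : Fin n → ℝ) : ℂ := ∑ j, a j * zz (θ j)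

lemma continuous_X {n : ℕ} (a : Fin n → ℂ) : Continuous (X a) := by
  unfold X
  exact continuous_finsetSum _ fun j _ => continuous_const.mul (continuous_zz.comp (continuous_apply j))

lemma norm_X_le {n : ℕ} (a : Fin n → ℂ) (θ : Fin n → ℝ) : ‖X a θ‖ ≤ ∑ j, ‖a j‖ := by
  refine (norm_sum_le _ _).trans (Finset.sum_le_sum fun j _ => ?_)
  rw [norm_mul, norm_zz, mul_one]

lemma zz_sum {ι : Type*} (s : Finset ι) (f : ι → ℝ) : zz (∑ i ∈ s, f i) = ∏ i ∈ s, zz (f i) := by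
  unfold zz; rw [← Complex.exp_sum, Complex.ofReal_sum, Finset.sum_mul]

lemma char_n {n : ℕ} (a : Fin n → ℂ) (t : ℝ) :
    ∫ θ, Real.cos (t * (X a θ).re) ∂(mu n) = ∏ j, J (t * ‖a j‖) := by
  have h1 := integral_fintype_prod_eq_prod (𝕜 := ℂ) (μ := fun _ : Fin n => nu)
    (fun j θ => zz (t * (a j * zz θ).re))
  simp_rw [char_one] at h1
  have h2 : ∀ θ : Fin n → ℝ, ∏ j, zz (t * (a j * zz (θ j)).re) = zz (t * (X a θ).re) := by
    intro θ
    rw [← zz_sum, X, Complex.re_sum, Finset.mul_sum]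
  simp_rw [h2] at h1
  have hc : Continuous (fun θ => zz (t * (X a θ).re)) :=
    continuous_zz.comp (continuous_const.mul (Complex.continuous_re.comp (continuous_X a)))
  have hint : Integrable (fun θ => zz (t * (X a θ).re)) (mu n) :=
    Integrable.of_bound (C := 1) hc.aestronglyMeasurable (Eventually.of_forall fun θ => (norm_zz _).le)
  have hre := integral_re hint
  simp only [RCLike.re_to_complex, zz_re] at hre
  rw [hre, mu, h1, ← Complex.ofReal_prod, Complex.ofReal_re]

lemma int_abs_cos : ∫ θ in (0:ℝ)..(2 * Real.pi), |Real.cos θ| = 4 := by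
  have hp : Function.Periodic (fun θ => |Real.cos θ|) (2 * Real.pi) := fun θ => by simp
  have := hp.intervalIntegral_add_eq (-(Real.pi/2)) 0
  rw [zero_add] at this
  have hi : ∀ a b : ℝ, IntervalIntegrable (fun θ => |Real.cos θ|) volume a b :=
    fun a b => Continuous.intervalIntegrable (by fun_prop) _ _
  have hpi := Real.pi_pos
  rw [← this, ← intervalIntegral.integral_add_adjacent_intervals (hi _ (Real.pi/2)) (hi _ _)]
  have e1 : ∫ θ in (-(Real.pi/2))..(Real.pi/2), |Real.cos θ| = ∫ θ in (-(Real.pi/2))..(Real.pi/2), Real.cos θ := by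
    apply intervalIntegral.integral_congr
    intro x hx
    rw [uIcc_of_le (by linarith)] at hx
    exact abs_of_nonneg (Real.cos_nonneg_of_mem_Icc hx)
  have e2 : ∫ θ in (Real.pi/2)..(-(Real.pi/2) + 2 * Real.pi), |Real.cos θ| =
      ∫ θ in (Real.pi/2)..(-(Real.pi/2) + 2 * Real.pi), -Real.cos θ := by
    apply intervalIntegral.integral_congr
    intro x hx
    rw [uIcc_of_le (by linarith)] at hx
    exact abs_of_nonpos (Real.cos_nonpos_of_pi_div_two_le_of_le hx.1 (by linarith [hx.2]))
  rw [e1, e2, intervalIntegral.integral_neg, integral_cos, integral_cos, Real.sin_add_two_pi]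
  simp
  norm_num

lemma avg_abs_re (w : ℂ) : ∫ φ, |(w * zz φ).re| ∂nu = 2 / Real.pi * ‖w‖ := by
  rw [nu_rot (fun v => |v.re|) w]
  simp only [Complex.re_ofReal_mul, zz_re, abs_mul, abs_norm]
  rw [integral_const_mul, nu_integral, int_abs_cos, smul_eq_mul]
  field_simp; norm_num

lemma X_integrable {n : ℕ} (a : Fin n → ℂ) : Integrable (X a) (mu n) :=
  Integrable.of_bound (C := ∑ j, ‖a j‖) (continuous_X a).aestronglyMeasurable
    (Eventually.of_forall fun θ => norm_X_le a θ)

theorem fourier {n : ℕ} (a : Fin n → ℂ) :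
    ∫ θ, ‖X a θ‖ ∂(mu n) = ∫ t in Ioi (0:ℝ), (1 - ∏ j, J (t * ‖a j‖)) / t ^ 2 := by
  have h1 : ∀ φ : ℝ, C0 * ∫ θ, |(X a θ * zz φ).re| ∂(mu n) =
      ∫ t in Ioi (0:ℝ), (1 - ∏ j, J (t * ‖a j‖)) / t ^ 2 := by
    intro φ
    have e : ∀ θ, X a θ * zz φ = X (fun j => a j * zz φ) θ := by
      intro θ; unfold X; rw [Finset.sum_mul]; congr 1; ext j; ring
    have hc := continuous_X (fun j => a j * zz φ)
    simp_rw [e]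
    rw [fubini_cos (mu n) (fun θ => (X (fun j => a j * zz φ) θ).re)
      (Complex.continuous_re.comp hc).measurable (X_integrable _).re]
    simp_rw [char_n]
    simp [norm_zz]
  have h2 : ∫ φ, ∫ θ, |(X a θ * zz φ).re| ∂(mu n) ∂nu = 2 / Real.pi * ∫ θ, ‖X a θ‖ ∂(mu n) := by
    rw [integral_integral_swap]
    · simp_rw [avg_abs_re]; rw [integral_const_mul]
    · have hc : Continuous (Function.uncurry fun (φ : ℝ) (θ : Fin n → ℝ) => |(X a θ * zz φ).re|) := by
        apply Continuous.abs
        apply Complex.continuous_re.comp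
        exact ((continuous_X a).comp continuous_snd).mul (continuous_zz.comp continuous_fst)
      refine Integrable.of_bound (C := ∑ j, ‖a j‖) hc.aestronglyMeasurable
        (Eventually.of_forall fun p => ?_)
      simp only [Function.uncurry, Real.norm_eq_abs, abs_abs]
      refine (Complex.abs_re_le_norm _).trans ?_
      rw [norm_mul, norm_zz, mul_one]
      exact norm_X_le _ _
  have h3 : ∫ φ, (C0 * ∫ θ, |(X a θ * zz φ).re| ∂(mu n)) ∂nu =
      ∫ t in Ioi (0:ℝ), (1 - ∏ j, J (t * ‖a j‖)) / t ^ 2 := by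
    simp_rw [h1]; simp
  rw [integral_const_mul, h2, C0_eq] at h3
  rw [← h3]
  field_simp

/-- splitting off a coordinate. -/
lemma mu_split {n : ℕ} (i : Fin (n+1)) (F : (Fin (n+1) → ℝ) → ℝ) (hF : Continuous F) (C : ℝ)
    (hC : ∀ θ, |F θ| ≤ C) :
    ∫ θ, F θ ∂(mu (n+1)) = ∫ y, ∫ x, F (i.insertNth x y) ∂nu ∂(mu n) := by
  have h := (measurePreserving_piFinSuccAbove (fun _ : Fin (n+1) => nu) i).symm
  have h2 := h.integral_comp' F
  have hc : Continuous fun p : ℝ × (Fin n → ℝ) => F (i.insertNth p.1 p.2) := by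
    apply hF.comp
    exact Continuous.finInsertNth (A := fun _ : Fin (n+1) => ℝ) i continuous_fst continuous_snd
  rw [mu, ← h2]
  simp only [MeasurableEquiv.piFinSuccAbove_symm_apply]
  rw [mu]
  exact integral_prod_symm (fun p : ℝ × (Fin n → ℝ) => F (i.insertNth p.1 p.2))
    (Integrable.of_bound (C := C) hc.aestronglyMeasurable (Eventually.of_forall fun p => hC _))

lemma X_insert {n : ℕ} (i : Fin (n+1)) (a : Fin (n+1) → ℂ) (x : ℝ) (y : Fin n → ℝ) :
    X a (i.insertNth x y) = a i * zz x + X (fun j => a (i.succAbove j)) y := by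
  unfold X
  rw [Fin.sum_univ_succAbove _ i]; simp

lemma avg_two : ∫ θ, ‖X (fun _ : Fin 2 => (1:ℂ)) θ‖ ∂(mu 2) = 4 / Real.pi := by
  rw [mu_split 0 _ (continuous_X _).norm 2 (fun θ => by
    rw [abs_norm]; refine (norm_X_le _ _).trans ?_; simp)]
  have key : ∀ y : Fin 1 → ℝ, ∫ x, ‖X (fun _ : Fin 2 => (1:ℂ)) ((0 : Fin 2).insertNth x y)‖ ∂nu = 4 / Real.pi := by
    intro y
    have e : ∀ x, ‖X (fun _ : Fin 2 => (1:ℂ)) ((0 : Fin 2).insertNth x y)‖ = (fun x => ‖zz x + 1‖) (x + (- y 0)) := by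
      intro x
      rw [X_insert]
      simp only [X, Finset.univ_unique, Fin.default_eq_zero, Finset.sum_singleton, one_mul]
      have : zz x + zz (y 0) = (zz (x + -y 0) + 1) * zz (y 0) := by
        rw [add_mul, ← zz_add]; ring_nf
      rw [this, norm_mul, norm_zz, mul_one]
    simp_rw [e]
    rw [nu_shift (fun x => ‖zz x + 1‖) (fun x => by simp only [zz_periodic x])]
    have e2 : ∀ x, ‖zz x + 1‖ = 2 * |Real.cos (x / 2)| := by
      intro x
      have : zz x + 1 = zz (x/2) * ((2 * Real.cos (x/2) : ℝ) : ℂ) := by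
        have h1 : zz x = zz (x/2) * zz (x/2) := by rw [← zz_add]; ring_nf
        have h2 : zz (x/2) * zz (-(x/2)) = 1 := by rw [← zz_add]; simp [zz]
        have h3 : ((2 * Real.cos (x/2) : ℝ) : ℂ) = zz (x/2) + zz (-(x/2)) := by
          apply Complex.ext
          · rw [Complex.ofReal_re, Complex.add_re, zz_re, zz_re, Real.cos_neg]; ring
          · rw [Complex.ofReal_im, Complex.add_im, zz_im, zz_im, Real.sin_neg]; ring
        rw [h3, mul_add, h2, ← h1]
      rw [this, norm_mul, norm_zz, one_mul, Complex.norm_real, Real.norm_eq_abs, abs_mul, abs_two]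
    simp_rw [e2]
    rw [integral_const_mul, nu_integral, intervalIntegral.integral_comp_div (fun x => |Real.cos x|) two_ne_zero]
    have e3 : ∫ x in (0/2:ℝ)..(2 * Real.pi/2), |Real.cos x| = 2 := by
      have h1 := int_abs_cos
      have hp : Function.Periodic (fun θ => |Real.cos θ|) (Real.pi) := fun θ => by simp
      have h2 := hp.intervalIntegral_add_eq Real.pi 0
      have hi : ∀ a b : ℝ, IntervalIntegrable (fun θ => |Real.cos θ|) volume a b :=
        fun a b => Continuous.intervalIntegrable (by fun_prop) _ _
      rw [← intervalIntegral.integral_add_adjacent_intervals (hi _ (Real.pi)) (hi _ _),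
        show 2 * Real.pi = Real.pi + Real.pi by ring, h2, zero_add] at h1
      rw [zero_div, show 2 * Real.pi / 2 = Real.pi by ring]
      linarith
    rw [e3]
    simp only [smul_eq_mul]
    field_simp; norm_num
  simp_rw [key]
  simp

lemma K_two : ∫ t in Ioi (0:ℝ), (1 - J t ^ 2) / t ^ 2 = 4 / Real.pi := by
  rw [← avg_two, fourier]
  simp [Finset.prod_const]

end SK

namespace SK
open MeasureTheory Set

/-- The basic integral. -/
noncomputable def K (s : ℝ) : ℝ := ∫ u in Ioi (0:ℝ), (1 - |J u| ^ s) / u ^ 2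

lemma J_rpow_le_one (u s : ℝ) (hs : 0 ≤ s) : |J u| ^ s ≤ 1 :=
  Real.rpow_le_one (abs_nonneg _) (abs_J_le u) hs

lemma one_sub_abs_J (u : ℝ) (hu : 0 ≤ u) : 1 - |J u| ≤ u ^ 2 / 4 := by
  have := J_ge_one u hu
  have := le_abs_self (J u)
  linarith

lemma K_integrable (s : ℝ) (hs : 1 ≤ s) : IntegrableOn (fun u => (1 - |J u| ^ s) / u ^ 2) (Ioi 0) := by
  have hc : Continuous (fun u => 1 - |J u| ^ s) :=
    continuous_const.sub (continuous_J.abs.rpow_const fun _ => Or.inr (by linarith))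
  apply int_div_sq hc.measurable (s / 4) 1
  · intro u hu
    have h1 := J_rpow_le_one u s (by linarith)
    have h2 := one_add_mul_self_le_rpow_one_add (s := |J u| - 1) (by linarith [abs_nonneg (J u)]) hs
    rw [add_sub_cancel] at h2
    have h3 := one_sub_abs_J u hu.le
    rw [abs_of_nonneg (by linarith)]
    nlinarith
  · intro u hu
    have h1 := J_rpow_le_one u s (by linarith)
    have h2 := Real.rpow_nonneg (abs_nonneg (J u)) s
    rw [abs_of_nonneg (by linarith)]
    linarith

lemma K_two' : K 2 = 4 / Real.pi := by
  rw [← K_two, K]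
  congr 1; ext u
  norm_num

lemma num_est : Real.sqrt (Real.pi / 2) + 195/10000 ≤ 4 / Real.pi := by
  have h1 := Real.pi_lt_d6
  have h2 := Real.pi_pos
  have h3 : Real.sqrt (Real.pi / 2) ≤ 1.25332 := by
    apply Real.sqrt_le_iff.2 ⟨by norm_num, by linarith⟩
  have h4 : 1.27323 ≤ 4 / Real.pi := by
    rw [le_div_iff₀ h2]; linarith
  linarith

theorem K_ge (s : ℝ) (hs : 2 ≤ s) : Real.sqrt Real.pi / 2 * Real.sqrt s ≤ K s := by
  have hy : 0 < y0 := Real.exp_pos _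
  set Y := y0 ^ (s - 2) with hY
  have hY0 : 0 ≤ Y := Real.rpow_nonneg hy.le _
  have i1 := K_integrable s (by linarith)
  have i2 := gauss_integrable (s/4) (by linarith)
  have i3 := K_integrable 2 (by norm_num)
  have i4 := gauss_integrable (1/2) (by norm_num)
  obtain ⟨i5, h5⟩ := tail_bound
  set g := (Ioi (189/100 : ℝ)).indicator (fun u : ℝ => Real.exp (-(1/2 * u^2)) / u^2) with hg
  have i6 : IntegrableOn g (Ioi 0) := ((integrable_indicator_iff measurableSet_Ioi).2 i5).integrableOn
  have e6 : ∫ u in Ioi (0:ℝ), g u = ∫ u in Ioi (189/100 : ℝ), Real.exp (-(1/2 * u^2)) / u^2 := by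
    rw [hg, setIntegral_indicator measurableSet_Ioi]
    congr 2
    ext x; simp; intro h; linarith
  have key : ∫ u in Ioi (0:ℝ), Y * ((1 - |J u| ^ (2:ℝ)) / u^2 - (1 - Real.exp (-(1/2 * u^2))) / u^2 - g u)
      ≤ ∫ u in Ioi (0:ℝ), ((1 - |J u| ^ s) / u^2 - (1 - Real.exp (-(s/4 * u^2))) / u^2) := by
    apply setIntegral_mono_on (((i3.sub i4).sub i6).const_mul _) (i1.sub i2) measurableSet_Ioi
    intro u hu
    have hu0 : 0 < u := hu
    have hu2 : 0 < u^2 := by positivity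
    have a1 : |J u| ^ s = |J u| ^ (s - 2) * |J u| ^ (2:ℝ) := by
      rw [← Real.rpow_add_of_nonneg (abs_nonneg _) (by linarith) (by norm_num)]; congr 1; ring
    set f := Real.exp (-(u^2/4)) with hf
    have hf0 : 0 < f := Real.exp_pos _
    have a2 : Real.exp (-(s/4 * u^2)) = f ^ (s-2) * Real.exp (-(1/2 * u^2)) := by
      rw [hf, ← Real.exp_mul, ← Real.exp_add]; congr 1; ring
    have a3 : Real.exp (-(1/2 * u^2)) = f ^ (2:ℝ) := by
      rw [hf, ← Real.exp_mul]; congr 1; ring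
    have hJ2 : 0 ≤ |J u| ^ (2:ℝ) := Real.rpow_nonneg (abs_nonneg _) _
    have hJs : 0 ≤ |J u| ^ (s-2) := Real.rpow_nonneg (abs_nonneg _) _
    have hs2 : 0 ≤ s - 2 := by linarith
    simp only [Pi.sub_apply]
    rw [a1, a2]
    by_cases h : u ≤ 189/100
    · have hgu : g u = 0 := indicator_of_notMem (by simpa using h) _
      rw [hgu, sub_zero, ← sub_div, ← sub_div, ← mul_div_assoc]
      apply div_le_div_of_nonneg_right _ hu2.le
      rw [a3]
      have b1 := J_small u hu0.le h
      have b2 : |J u| ^ (s-2) ≤ f ^ (s-2) := Real.rpow_le_rpow (abs_nonneg _) b1 hs2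
      have b3 : |J u| ^ (2:ℝ) ≤ f ^ (2:ℝ) := Real.rpow_le_rpow (abs_nonneg _) b1 (by norm_num)
      have b4 : Y ≤ f ^ (s-2) := by
        apply Real.rpow_le_rpow hy.le _ hs2
        rw [hf, y0]; apply Real.exp_le_exp.2
        nlinarith
      have c1 := mul_le_mul_of_nonneg_right b2 hJ2
      have c2 := mul_le_mul_of_nonneg_right b4 (sub_nonneg.2 b3)
      linarith [c1, c2, mul_sub Y (f ^ (2:ℝ)) (|J u| ^ (2:ℝ)), mul_sub (f ^ (s-2)) (f ^ (2:ℝ)) (|J u| ^ (2:ℝ)),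
        show Y * (1 - |J u| ^ (2:ℝ) - (1 - f ^ (2:ℝ))) = Y * (f ^ (2:ℝ) - |J u| ^ (2:ℝ)) by ring]
    · push Not at h
      have hgu : g u = Real.exp (-(1/2 * u^2)) / u^2 := indicator_of_mem (by simpa using h) _
      rw [hgu, ← sub_div, ← sub_div, ← sub_div, ← mul_div_assoc]
      apply div_le_div_of_nonneg_right _ hu2.le
      have b2 : |J u| ^ (s-2) ≤ Y := Real.rpow_le_rpow (abs_nonneg _) (J_large u h.le) hs2
      have b5 : 0 ≤ f ^ (s-2) * Real.exp (-(1/2 * u^2)) := by positivity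
      have c1 := mul_le_mul_of_nonneg_right b2 hJ2
      have c3 : Y * (1 - |J u| ^ (2:ℝ) - (1 - Real.exp (-(1/2 * u^2))) - Real.exp (-(1/2 * u^2)))
        = - (Y * |J u| ^ (2:ℝ)) := by ring
      rw [c3]
      linarith
  have i34 : IntegrableOn (fun u => (1 - |J u| ^ (2:ℝ)) / u^2 - (1 - Real.exp (-(1/2 * u^2))) / u^2) (Ioi 0) :=
    i3.sub i4
  rw [integral_const_mul, integral_sub i34 i6, integral_sub i3 i4, integral_sub i1 i2,
    gauss_integral _ (by norm_num), gauss_integral _ (by linarith), e6] at key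
  have hk : ∫ u in Ioi (0:ℝ), (1 - |J u| ^ (2:ℝ)) / u^2 = 4 / Real.pi := K_two'
  rw [hk] at key
  have e7 : Real.sqrt (Real.pi * (s/4)) = Real.sqrt Real.pi / 2 * Real.sqrt s := by
    rw [show Real.pi * (s/4) = (Real.pi * s) / 2^2 by ring, Real.sqrt_div (by positivity),
      Real.sqrt_sq (by norm_num), Real.sqrt_mul Real.pi_pos.le]; ring
  rw [e7] at key
  have e8 := num_est
  rw [show Real.pi * (1/2) = Real.pi / 2 by ring] at key
  have : 0 ≤ Y * (4 / Real.pi - Real.sqrt (Real.pi / 2) - ∫ u in Ioi (189/100 : ℝ), Real.exp (-(1/2 * u^2)) / u^2) := by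
    apply mul_nonneg hY0; linarith
  unfold K
  linarith

end SK

namespace SK
open MeasureTheory Set

lemma K_scale (a s : ℝ) (ha : 0 ≤ a) :
    ∫ t in Ioi (0:ℝ), (1 - |J (t * a)| ^ s) / t ^ 2 = a * K s := by
  rcases ha.eq_or_lt with rfl | ha
  · simp [J_zero]
  have h := integral_comp_mul_right_Ioi (fun t => (1 - |J t| ^ s) / t ^ 2) 0 ha
  simp only [zero_mul, smul_eq_mul] at h
  have e : ∀ t : ℝ, (1 - |J (t * a)| ^ s) / t ^ 2 = a^2 * ((1 - |J (t * a)| ^ s) / (t * a) ^ 2) := by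
    intro t
    rcases eq_or_ne t 0 with rfl | ht
    · simp
    field_simp
  simp_rw [e]
  rw [integral_const_mul, h, K]
  field_simp

lemma K_scale_integrable (a s : ℝ) (ha : 0 ≤ a) (hs : 1 ≤ s) :
    IntegrableOn (fun t => (1 - |J (t * a)| ^ s) / t ^ 2) (Ioi 0) := by
  have hc : Continuous (fun u => 1 - |J (u * a)| ^ s) :=
    continuous_const.sub ((continuous_J.comp (continuous_mul_const a)).abs.rpow_const
      fun _ => Or.inr (by linarith))
  apply int_div_sq hc.measurable (s / 4 * a^2) 1
  · intro u hu
    have h1 := J_rpow_le_one (u * a) s (by linarith)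
    have h2 := one_add_mul_self_le_rpow_one_add (s := |J (u*a)| - 1) (by linarith [abs_nonneg (J (u*a))]) hs
    rw [add_sub_cancel] at h2
    have h3 := one_sub_abs_J (u * a) (by positivity)
    rw [abs_of_nonneg (by linarith)]
    nlinarith
  · intro u hu
    have h1 := J_rpow_le_one (u * a) s (by linarith)
    have h2 := Real.rpow_nonneg (abs_nonneg (J (u*a))) s
    rw [abs_of_nonneg (by linarith)]
    linarith

lemma prod_est {ι : Type*} (s : Finset ι) (x : ι → ℝ) (h : ∀ i, |x i| ≤ 1) :
    |∏ i ∈ s, x i| ≤ 1 ∧ |1 - ∏ i ∈ s, x i| ≤ ∑ i ∈ s, |1 - x i| := by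
  classical
  induction s using Finset.induction_on with
  | empty => simp
  | insert i s hi ih =>
    rw [Finset.prod_insert hi, Finset.sum_insert hi]
    constructor
    · rw [abs_mul]; exact mul_le_one₀ (h i) (abs_nonneg _) ih.1
    · have : 1 - x i * ∏ j ∈ s, x j = (1 - x i) + x i * (1 - ∏ j ∈ s, x j) := by ring
      rw [this]
      refine (abs_add_le _ _).trans (add_le_add le_rfl ?_)
      rw [abs_mul]
      calc _ ≤ 1 * |1 - ∏ j ∈ s, x j| := by gcongr; exact h i
        _ ≤ _ := by rw [one_mul]; exact ih.2

lemma fourier_integrable {n : ℕ} (a : Fin n → ℝ) (ha : ∀ i, 0 ≤ a i) :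
    IntegrableOn (fun t => (1 - ∏ j, J (t * a j)) / t ^ 2) (Ioi 0) := by
  have hc : Continuous (fun t => 1 - ∏ j, J (t * a j)) :=
    continuous_const.sub (continuous_finsetProd _ fun j _ => continuous_J.comp (continuous_mul_const _))
  apply int_div_sq hc.measurable (∑ j, (a j)^2/4) 2
  · intro u hu
    refine (prod_est Finset.univ (fun j => J (u * a j)) (fun j => abs_J_le _)).2.trans ?_
    rw [Finset.sum_mul]
    apply Finset.sum_le_sum
    intro j _
    have h1 := J_ge_one (u * a j) (mul_nonneg hu.le (ha j))
    have h2 := (abs_le.1 (abs_J_le (u * a j))).2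
    rw [abs_of_nonneg (by linarith)]
    nlinarith
  · intro u hu
    have h := (prod_est Finset.univ (fun j => J (u * a j)) (fun j => abs_J_le _)).1
    have := abs_le.1 h
    rw [abs_le]; constructor <;> linarith

lemma weighted {n : ℕ} (a : Fin n → ℂ) (p : Fin n → ℝ) (hp0 : ∀ i, 0 ≤ p i) (hp1 : ∑ i, p i = 1)
    (hz : ∀ i, p i = 0 → a i = 0) :
    ∑ i, p i * (‖a i‖ * K (1 / p i)) ≤ ∫ θ, ‖X a θ‖ ∂(mu n) := by
  have hple : ∀ i, p i ≤ 1 := fun i => by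
    rw [← hp1]; exact Finset.single_le_sum (fun j _ => hp0 j) (Finset.mem_univ i)
  rw [fourier]
  have hi : ∀ i, IntegrableOn (fun t => p i * ((1 - |J (t * ‖a i‖)| ^ (1 / p i)) / t ^ 2)) (Ioi 0) := by
    intro i
    rcases (hp0 i).eq_or_lt with h | h
    · rw [← h]; simp
    · exact (K_scale_integrable _ _ (norm_nonneg _) (by rw [le_div_iff₀ h]; linarith [hple i])).const_mul _
  have e : ∑ i, p i * (‖a i‖ * K (1 / p i)) =
      ∫ t in Ioi (0:ℝ), ∑ i, p i * ((1 - |J (t * ‖a i‖)| ^ (1 / p i)) / t ^ 2) := by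
    rw [integral_finsetSum _ (fun i _ => hi i)]
    apply Finset.sum_congr rfl
    intro i _
    rw [integral_const_mul, K_scale _ _ (norm_nonneg _)]
  rw [e]
  apply setIntegral_mono_on (integrable_finsetSum _ (fun i _ => hi i))
    (fourier_integrable _ fun i => norm_nonneg _) measurableSet_Ioi
  intro t ht
  have ht0 : 0 < t := ht
  have : ∑ i, p i * ((1 - |J (t * ‖a i‖)| ^ (1 / p i)) / t ^ 2) =
      (1 - ∑ i, p i * |J (t * ‖a i‖)| ^ (1 / p i)) / t^2 := by
    have h0 : (1:ℝ) - ∑ i, p i * |J (t * ‖a i‖)| ^ (1 / p i) =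
        ∑ i, (p i - p i * |J (t * ‖a i‖)| ^ (1 / p i)) := by
      rw [Finset.sum_sub_distrib, hp1]
    rw [h0, Finset.sum_div]
    apply Finset.sum_congr rfl; intro i _; ring
  rw [this]
  apply div_le_div_of_nonneg_right _ (by positivity)
  have h1 := Real.geom_mean_le_arith_mean_weighted Finset.univ p (fun i => |J (t * ‖a i‖)| ^ (1 / p i))
    (fun i _ => hp0 i) hp1 (fun i _ => Real.rpow_nonneg (abs_nonneg _) _)
  have h2 : ∏ i, (|J (t * ‖a i‖)| ^ (1 / p i)) ^ p i = |∏ i, J (t * ‖a i‖)| := by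
    rw [Finset.abs_prod]
    apply Finset.prod_congr rfl
    intro i _
    rcases (hp0 i).eq_or_lt with h | h
    · rw [← h, hz i h.symm]; simp [J_zero]
    · rw [← Real.rpow_mul (abs_nonneg _), one_div, inv_mul_cancel₀ h.ne', Real.rpow_one]
  rw [h2] at h1
  have := le_abs_self (∏ i, J (t * ‖a i‖))
  linarith

/-- Khinchine constant -/
noncomputable def cc : ℝ := Real.sqrt Real.pi / 2

lemma cc_sq : cc ^ 2 = Real.pi / 4 := by
  unfold cc; rw [div_pow, Real.sq_sqrt Real.pi_pos.le]; norm_num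
lemma cc_pos : 0 < cc := by unfold cc; have := Real.sqrt_pos.2 Real.pi_pos; positivity
lemma cc_le : cc ≤ 88623/100000 := by
  have := cc_sq; have := cc_pos; have := Real.pi_lt_d6
  by_contra h; push Not at h; nlinarith

lemma pK (p : ℝ) (hp : 0 ≤ p) (hp2 : p ≤ 1/2) : cc * Real.sqrt p ≤ p * K (1 / p) := by
  rcases hp.eq_or_lt with rfl | h
  · simp
  have h1 := K_ge (1/p) (by rw [le_div_iff₀ h]; linarith)
  have h2 : cc * Real.sqrt p = p * (cc * Real.sqrt (1/p)) := by
    rw [Real.sqrt_div zero_le_one, Real.sqrt_one]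
    have := Real.sqrt_pos.2 h
    have h3 := Real.mul_self_sqrt hp
    field_simp
    rw [sq, h3]
  rw [h2]
  exact mul_le_mul_of_nonneg_left h1 hp

lemma caseA {n : ℕ} (a : Fin n → ℂ) (h1 : ∑ i, ‖a i‖^2 = 1) (h2 : ∀ i, ‖a i‖^2 ≤ 1/2) :
    cc ≤ ∫ θ, ‖X a θ‖ ∂(mu n) := by
  refine le_trans ?_ (weighted a (fun i => ‖a i‖^2) (fun i => sq_nonneg _) h1 (fun i h => by simpa using h))
  calc cc = ∑ i, cc * ‖a i‖^2 := by rw [← Finset.mul_sum, h1, mul_one]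
    _ ≤ _ := by
      apply Finset.sum_le_sum
      intro i _
      have := pK (‖a i‖^2) (sq_nonneg _) (h2 i)
      rw [Real.sqrt_sq (norm_nonneg _)] at this
      have := mul_le_mul_of_nonneg_right this (norm_nonneg (a i))
      nlinarith

lemma caseB_num (a b : ℝ) (ha : 1/2 ≤ a^2) (ha0 : 0 ≤ a) (ha2 : a ≤ 793/1000) (hb : 0 ≤ b) (h : a^2 + b^2 = 1) :
    cc ≤ 2 / Real.pi * a + cc / Real.sqrt 2 * b := by
  have h1 : 63661/100000 ≤ 2 / Real.pi := by
    rw [le_div_iff₀ Real.pi_pos]; have := Real.pi_lt_d6; linarith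
  have h2 : 62665/100000 ≤ cc / Real.sqrt 2 := by
    have e : (cc / Real.sqrt 2)^2 = Real.pi / 8 := by
      rw [div_pow, cc_sq, Real.sq_sqrt (by norm_num)]; ring
    have : 0 ≤ cc / Real.sqrt 2 := by have := cc_pos; positivity
    have := Real.pi_gt_d6
    by_contra h; push Not at h; nlinarith
  have h3 : 7071/10000 ≤ a := by by_contra h; push Not at h; nlinarith
  have h4 : 6092/10000 + 11/10 * (793/1000 - a) ≤ b := by
    apply le_of_sq_le_sq _ hb
    nlinarith [mul_nonneg (sub_nonneg.2 h3) (sub_nonneg.2 ha2)]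
  have := cc_le
  nlinarith [mul_le_mul_of_nonneg_right h1 ha0, mul_le_mul_of_nonneg_right h2 hb]

lemma caseB {n : ℕ} (a : Fin n → ℂ) (h1 : ∑ i, ‖a i‖^2 = 1) (i0 : Fin n) (h2 : 1/2 ≤ ‖a i0‖^2)
    (h3 : ‖a i0‖ ≤ 793/1000) : cc ≤ ∫ θ, ‖X a θ‖ ∂(mu n) := by
  classical
  have hsplit : ∀ f : Fin n → ℝ, ∑ i, f i = f i0 + ∑ i ∈ Finset.univ.erase i0, f i := fun f =>
    (Finset.add_sum_erase _ _ (Finset.mem_univ i0)).symm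
  set B := 1 - ‖a i0‖^2 with hB
  have hB0 : 0 < B := by nlinarith [norm_nonneg (a i0)]
  have hsum : ∑ i ∈ Finset.univ.erase i0, ‖a i‖^2 = B := by
    have := hsplit (fun i => ‖a i‖^2); linarith
  set p : Fin n → ℝ := fun i => if i = i0 then 1/2 else ‖a i‖^2 / (2 * B) with hp
  have hpi0 : p i0 = 1/2 := by simp [hp]
  have hpi : ∀ i ∈ Finset.univ.erase i0, p i = ‖a i‖^2/(2*B) := fun i hi => by
    simp [hp, (Finset.mem_erase.1 hi).1]
  have hp0 : ∀ i, 0 ≤ p i := fun i => by simp only [hp]; split_ifs <;> positivity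
  have hp1 : ∑ i, p i = 1 := by
    rw [hsplit, hpi0, Finset.sum_congr rfl hpi, ← Finset.sum_div, hsum]; field_simp; norm_num
  have hz : ∀ i, p i = 0 → a i = 0 := by
    intro i hi
    by_cases h : i = i0
    · rw [h, hpi0] at hi; norm_num at hi
    · rw [hpi i (by simp [h])] at hi
      have : ‖a i‖^2 = 0 := by
        rcases div_eq_zero_iff.1 hi with h | h
        · exact h
        · linarith
      simpa using this
  refine le_trans ?_ (weighted a p hp0 hp1 hz)
  rw [hsplit, hpi0]
  have e1 : (1:ℝ) / (1/2) = 2 := by norm_num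
  rw [e1, K_two']
  have e2 : cc / Real.sqrt 2 * Real.sqrt B ≤ ∑ i ∈ Finset.univ.erase i0, p i * (‖a i‖ * K (1 / p i)) := by
    have : cc / Real.sqrt 2 * Real.sqrt B = ∑ i ∈ Finset.univ.erase i0, cc / (Real.sqrt 2 * Real.sqrt B) * ‖a i‖^2 := by
      rw [← Finset.mul_sum, hsum]
      have := Real.sqrt_pos.2 hB0
      have h5 := Real.mul_self_sqrt hB0.le
      field_simp
      rw [sq, h5]
    rw [this]
    apply Finset.sum_le_sum
    intro i hi
    have hle : p i ≤ 1/2 := by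
      rw [hpi i hi, div_le_iff₀ (by positivity)]
      have := Finset.single_le_sum (f := fun i => ‖a i‖^2) (fun j _ => sq_nonneg _) hi
      rw [hsum] at this
      linarith
    have h5 := pK (p i) (hp0 i) hle
    have h6 : Real.sqrt (p i) = ‖a i‖ / (Real.sqrt 2 * Real.sqrt B) := by
      rw [hpi i hi, Real.sqrt_div (sq_nonneg _), Real.sqrt_sq (norm_nonneg _), Real.sqrt_mul (by norm_num)]
    rw [h6] at h5
    have := mul_le_mul_of_nonneg_right h5 (norm_nonneg (a i))
    calc _ = cc * (‖a i‖ / (Real.sqrt 2 * Real.sqrt B)) * ‖a i‖ := by ring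
      _ ≤ _ := this
      _ = _ := by ring
  have e3 := caseB_num ‖a i0‖ (Real.sqrt B) h2 (norm_nonneg _) h3 (Real.sqrt_nonneg _)
    (by rw [Real.sq_sqrt hB0.le]; ring)
  have e4 : 1/2 * (‖a i0‖ * (4 / Real.pi)) = 2 / Real.pi * ‖a i0‖ := by ring
  rw [e4]
  linarith

end SK

namespace SK
open MeasureTheory Set

lemma nsq (p q s t : ℝ) : ‖(p : ℂ) * zz s + q * zz t‖ =
    Real.sqrt (p^2 + q^2 + 2 * p * q * Real.cos (s - t)) := by
  rw [← Real.sqrt_sq (norm_nonneg _), ← Complex.normSq_eq_norm_sq, Complex.normSq_apply]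
  congr 1
  simp only [Complex.add_re, Complex.add_im, Complex.re_ofReal_mul, Complex.im_ofReal_mul, zz_re, zz_im]
  rw [Real.cos_sub]
  have h1 := Real.sin_sq_add_cos_sq s
  have h2 := Real.sin_sq_add_cos_sq t
  linear_combination p^2 * h1 + q^2 * h2

lemma nu_red (G : ℝ → ℝ) (a Y : ℂ) : ∫ x, G ‖a * zz x + Y‖ ∂nu =
    ∫ x, G (Real.sqrt (‖a‖^2 + ‖Y‖^2 + 2 * ‖a‖ * ‖Y‖ * Real.cos x)) ∂nu := by
  rw [← nu_shift (fun x => G (Real.sqrt (‖a‖^2 + ‖Y‖^2 + 2 * ‖a‖ * ‖Y‖ * Real.cos x)))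
    (fun x => by simp) (a.arg - Y.arg)]
  congr 1; ext x
  congr 1
  have : a * zz x + Y = ‖a‖ * zz (x + a.arg) + ‖Y‖ * zz Y.arg := by
    rw [← polar Y]
    conv_lhs => rw [polar a]
    rw [zz_add]; ring
  rw [this, nsq]
  ring_nf

lemma int_nu_of_cont {f : ℝ → ℝ} (hf : Continuous f) : Integrable f nu := by
  unfold nu
  apply Integrable.smul_measure _ ENNReal.ofReal_ne_top
  exact (hf.integrableOn_Icc (a := 0) (b := 2 * Real.pi)).mono_set Ioc_subset_Icc_self

lemma nu_cos : ∫ x, Real.cos x ∂nu = 0 := by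
  have := nu_shift (fun x => Real.cos x) (fun x => by simp) Real.pi
  simp only [Real.cos_add_pi, integral_neg] at this
  linarith

lemma nu_sin_sq_cos : ∫ x, Real.sin x ^ 2 * Real.cos x ∂nu = 0 := by
  have := nu_shift (fun x => Real.sin x ^ 2 * Real.cos x) (fun x => by simp) Real.pi
  simp only [Real.cos_add_pi, Real.sin_add_pi, mul_neg, integral_neg, neg_sq] at this
  linarith

lemma nu_sin_sq : ∫ x, Real.sin x ^ 2 ∂nu = 1/2 := by
  rw [nu_integral, integral_sin_sq]
  simp
  field_simp

lemma nu_quad (A B C D : ℝ) : ∫ x, (A + B * Real.cos x + C * Real.sin x ^ 2 + D * (Real.sin x ^ 2 * Real.cos x)) ∂nu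
    = A + C / 2 := by
  rw [integral_add, integral_add, integral_add, integral_const_mul, integral_const_mul, integral_const_mul,
    nu_cos, nu_sin_sq, nu_sin_sq_cos]
  · simp; ring
  all_goals exact int_nu_of_cont (by fun_prop)

lemma arg_nonneg (a r x : ℝ) : 0 ≤ a^2 + r^2 + 2 * a * r * Real.cos x := by
  have := Real.sin_sq_add_cos_sq x
  have : a^2 + r^2 + 2 * a * r * Real.cos x = (a + r * Real.cos x)^2 + (r * Real.sin x)^2 := by
    linear_combination (-r^2) * this
  rw [this]; positivity

lemma ptwise (ρ x y : ℝ) (hρ : 0 ≤ ρ) (h : ρ^2 = x^2 + y^2) :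
    x + y^2 - 1/4 * y^2 * ((1 + ρ^2)/2 + x) ≤ ρ := by
  have h1 : ρ ≤ (1 + ρ^2)/2 := by nlinarith [sq_nonneg (ρ - 1)]
  have h2 : x + y^2 - 1/4 * y^2 * (ρ + x) ≤ ρ := by
    have hs : 0 ≤ ρ + x := by nlinarith [abs_le_of_sq_le_sq (by nlinarith [sq_nonneg y] : x^2 ≤ ρ^2) hρ]
    have hd : 0 ≤ ρ - x := by nlinarith [abs_le_of_sq_le_sq (by nlinarith [sq_nonneg y] : x^2 ≤ ρ^2) hρ]
    have : y^2 = (ρ + x) * (ρ - x) := by linear_combination -h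
    rw [this]
    nlinarith [mul_nonneg hd (sq_nonneg (ρ + x - 2))]
  nlinarith [mul_nonneg (sq_nonneg y) (sub_nonneg.2 h1)]

lemma oneD (a r : ℝ) : a + r^2/2 - (1+a)^2*r^2/16 - r^4/16 ≤
    ∫ x, Real.sqrt (a^2 + r^2 + 2 * a * r * Real.cos x) ∂nu := by
  have h := nu_quad a r (r^2 * (1 - (1 + a^2 + r^2)/8 - a/4)) (-(1/4) * r^2 * (a * r + r))
  have e : a + r^2/2 - (1+a)^2*r^2/16 - r^4/16 = a + (r^2 * (1 - (1 + a^2 + r^2)/8 - a/4))/2 := by ring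
  rw [e, ← h]
  apply integral_mono (int_nu_of_cont (by fun_prop)) (int_nu_of_cont (by fun_prop))
  intro x
  have h1 := ptwise (Real.sqrt (a^2 + r^2 + 2 * a * r * Real.cos x)) (a + r * Real.cos x) (r * Real.sin x)
    (Real.sqrt_nonneg _) (by
      rw [Real.sq_sqrt (arg_nonneg a r x)]
      have := Real.sin_sq_add_cos_sq x
      linear_combination (-r^2) * this)
  rw [Real.sq_sqrt (arg_nonneg a r x)] at h1
  refine le_trans (le_of_eq ?_) h1
  ring

lemma m2 (a Y : ℂ) : ∫ x, ‖a * zz x + Y‖^2 ∂nu = ‖a‖^2 + ‖Y‖^2 := by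
  rw [nu_red (fun v => v^2)]
  have h := nu_quad (‖a‖^2 + ‖Y‖^2) (2 * ‖a‖ * ‖Y‖) 0 0
  rw [zero_div, add_zero] at h
  refine Eq.trans ?_ h
  congr 1; ext x
  rw [Real.sq_sqrt (arg_nonneg _ _ _)]; ring

lemma m4 (a Y : ℂ) : ∫ x, ‖a * zz x + Y‖^4 ∂nu = ‖Y‖^4 + 4 * ‖a‖^2 * ‖Y‖^2 + ‖a‖^4 := by
  rw [nu_red (fun v => v^4)]
  have h := nu_quad ((‖a‖^2 + ‖Y‖^2)^2 + 4 * ‖a‖^2*‖Y‖^2) (4 * ‖a‖ * ‖Y‖ * (‖a‖^2 + ‖Y‖^2))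
    (-(4 * ‖a‖^2*‖Y‖^2)) 0
  rw [show ‖Y‖^4 + 4 * ‖a‖^2 * ‖Y‖^2 + ‖a‖^4 =
    (‖a‖^2 + ‖Y‖^2)^2 + 4 * ‖a‖^2*‖Y‖^2 + (-(4 * ‖a‖^2*‖Y‖^2))/2 by ring, ← h]
  congr 1; ext x
  rw [show ∀ v : ℝ, v^4 = (v^2)^2 by intro v; ring, Real.sq_sqrt (arg_nonneg _ _ _)]
  have := Real.sin_sq_add_cos_sq x
  linear_combination (4 * ‖a‖^2*‖Y‖^2) * this

lemma pow_int {n : ℕ} (a : Fin n → ℂ) (k : ℕ) : Integrable (fun θ => ‖X a θ‖^k) (mu n) := by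
  refine Integrable.of_bound (C := (∑ j, ‖a j‖)^k) ((continuous_X a).norm.pow k).aestronglyMeasurable
    (Eventually.of_forall fun θ => ?_)
  rw [norm_pow, norm_norm]
  exact pow_le_pow_left₀ (norm_nonneg _) (norm_X_le a θ) k

lemma split_pow {n : ℕ} (i : Fin (n+1)) (a : Fin (n+1) → ℂ) (k : ℕ) :
    ∫ θ, ‖X a θ‖^k ∂(mu (n+1)) =
    ∫ y, ∫ x, ‖a i * zz x + X (fun j => a (i.succAbove j)) y‖^k ∂nu ∂(mu n) := by
  rw [mu_split i (fun θ => ‖X a θ‖^k) ((continuous_X a).norm.pow k) ((∑ j, ‖a j‖)^k) (fun θ => by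
    rw [abs_of_nonneg (by positivity)]
    exact pow_le_pow_left₀ (norm_nonneg _) (norm_X_le a θ) k)]
  simp_rw [X_insert]

lemma moment2 {n : ℕ} (a : Fin n → ℂ) : ∫ θ, ‖X a θ‖^2 ∂(mu n) = ∑ j, ‖a j‖^2 := by
  induction n with
  | zero => simp [X]
  | succ n ih =>
    rw [split_pow 0]
    simp_rw [m2]
    rw [integral_add (integrable_const _) (pow_int _ 2), ih, Fin.sum_univ_succ]
    simp

lemma moment4 {n : ℕ} (a : Fin n → ℂ) : ∫ θ, ‖X a θ‖^4 ∂(mu n) ≤ 2 * (∑ j, ‖a j‖^2)^2 := by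
  induction n with
  | zero => simp [X]
  | succ n ih =>
    rw [split_pow 0]
    simp_rw [m4]
    have i42 : Integrable (fun y => ‖X (fun j => a (Fin.succAbove 0 j)) y‖ ^ 4 +
      4 * ‖a 0‖ ^ 2 * ‖X (fun j => a (Fin.succAbove 0 j)) y‖ ^ 2) (mu n) :=
      (pow_int _ 4).add ((pow_int _ 2).const_mul _)
    rw [integral_add i42 (integrable_const _),
      integral_add (pow_int _ 4) ((pow_int _ 2).const_mul _), integral_const_mul, moment2, Fin.sum_univ_succ]
    have h := ih (fun j => a (Fin.succAbove 0 j))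
    simp only [Fin.succAbove_zero, integral_const, probReal_univ, smul_eq_mul, one_mul] at h ⊢
    nlinarith [sq_nonneg (‖a 0‖^2)]

lemma caseC {n : ℕ} (a : Fin n → ℂ) (h1 : ∑ i, ‖a i‖^2 = 1) (i0 : Fin n)
    (h3 : 793/1000 ≤ ‖a i0‖) : cc ≤ ∫ θ, ‖X a θ‖ ∂(mu n) := by
  cases n with
  | zero => exact i0.elim0
  | succ n =>
    have hs := split_pow i0 a 1
    simp only [pow_one] at hs
    rw [hs]
    set Z := X (fun j => a (i0.succAbove j)) with hZ
    set A := ‖a i0‖ with hA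
    have i2 := pow_int (fun j => a (i0.succAbove j)) 2
    have i4 := pow_int (fun j => a (i0.succAbove j)) 4
    have e2 := moment2 (fun j => a (i0.succAbove j))
    have e4 := moment4 (fun j => a (i0.succAbove j))
    rw [Fin.sum_univ_succAbove _ i0] at h1
    set b := ∑ j, ‖a (i0.succAbove j)‖^2 with hb
    have hb0 : 0 ≤ b := Finset.sum_nonneg fun j _ => sq_nonneg _
    rw [← hZ] at i2 i4 e2 e4
    have low : ∫ y, (A + (1/2 - (1+A)^2/16) * ‖Z y‖^2 - 1/16 * ‖Z y‖^4) ∂(mu n) ≤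
        ∫ y, ∫ x, ‖a i0 * zz x + Z y‖ ∂nu ∂(mu n) := by
      apply integral_mono (((integrable_const _).add (i2.const_mul _)).sub (i4.const_mul _))
      · have hc : Continuous (fun p : (Fin n → ℝ) × ℝ => ‖a i0 * zz p.2 + Z p.1‖) :=
          ((continuous_const.mul (continuous_zz.comp continuous_snd)).add
            ((continuous_X _).comp continuous_fst)).norm
        have : Integrable (fun p : (Fin n → ℝ) × ℝ => ‖a i0 * zz p.2 + Z p.1‖) ((mu n).prod nu) := by
          refine Integrable.of_bound (C := A + ∑ j, ‖a (i0.succAbove j)‖) hc.aestronglyMeasurable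
            (Eventually.of_forall fun p => ?_)
          rw [norm_norm]
          refine (norm_add_le _ _).trans (add_le_add ?_ (norm_X_le _ _))
          rw [norm_mul, norm_zz, mul_one]
        exact this.integral_prod_left
      · intro y
        simp only [Pi.sub_apply, Pi.add_apply]
        rw [nu_red (fun v => v)]
        refine le_trans (le_of_eq ?_) (oneD A ‖Z y‖)
        ring
    refine le_trans ?_ low
    have i2' : Integrable (fun y => A + (1/2 - (1+A)^2/16) * ‖Z y‖^2) (mu n) :=
      (integrable_const _).add (i2.const_mul _)
    rw [integral_sub i2' (i4.const_mul _), integral_add (integrable_const _) (i2.const_mul _),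
      integral_const_mul, integral_const_mul, e2]
    simp only [integral_const, probReal_univ, smul_eq_mul, one_mul]
    have hA1 : A ≤ 1 := by nlinarith
    have hbe : b = 1 - A^2 := by linarith
    have hc := cc_le
    rw [hbe] at e4 ⊢
    have hf : 88623/100000 ≤ A + (1 - A^2) * (5 - 2 * A + A^2)/16 := by
      have hA0 : 0 ≤ A - 793/1000 := by linarith
      have hA2 : 0 ≤ 1 - A := by linarith
      have h9 : 0 ≤ (A - 793/1000) * (1 - A) := mul_nonneg hA0 hA2
      nlinarith [mul_nonneg h9 hA0, mul_nonneg h9 hA2, mul_nonneg h9 (mul_nonneg hA0 hA2)]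
    nlinarith

lemma khin1 {n : ℕ} (a : Fin n → ℂ) (h1 : ∑ i, ‖a i‖^2 = 1) : cc ≤ ∫ θ, ‖X a θ‖ ∂(mu n) := by
  by_cases h : ∀ i, ‖a i‖^2 ≤ 1/2
  · exact caseA a h1 h
  push Not at h
  obtain ⟨i, hi⟩ := h
  rcases le_total ‖a i‖ (793/1000) with h3 | h3
  · exact caseB a h1 i hi.le h3
  · exact caseC a h1 i h3

theorem khinchine {n : ℕ} (a : Fin n → ℂ) :
    cc * Real.sqrt (∑ i, ‖a i‖^2) ≤ ∫ θ, ‖X a θ‖ ∂(mu n) := by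
  set σ := Real.sqrt (∑ i, ‖a i‖^2) with hσ
  have hsum : 0 ≤ ∑ i, ‖a i‖^2 := Finset.sum_nonneg fun j _ => sq_nonneg _
  rcases (Real.sqrt_nonneg (∑ i, ‖a i‖^2)).eq_or_lt with h | h
  · rw [hσ, ← h, mul_zero]; exact integral_nonneg fun _ => norm_nonneg _
  have hσ0 : 0 < σ := h
  have h1 := khin1 (fun i => a i / σ) (by
    simp only [norm_div, div_pow, Complex.norm_real, Real.norm_eq_abs, sq_abs]
    rw [← Finset.sum_div, hσ, Real.sq_sqrt hsum, div_self]
    intro h0; rw [hσ, h0, Real.sqrt_zero] at hσ0; exact lt_irrefl _ hσ0)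
  have e : ∀ θ, ‖X (fun i => a i / σ) θ‖ = ‖X a θ‖ / σ := by
    intro θ
    have : X (fun i => a i / σ) θ = X a θ / σ := by
      unfold X; rw [Finset.sum_div]; congr 1; ext j; ring
    rw [this, norm_div, Complex.norm_real, Real.norm_of_nonneg hσ0.le]
  simp_rw [e] at h1
  rwa [integral_div, le_div_iff₀ hσ0] at h1

end SK

namespace SK
open MeasureTheory Set

lemma minkowski {n : ℕ} {P : Type*} [Fintype P] (a : P → Fin n → ℂ) :
    cc * Real.sqrt (∑ p, ∑ j, ‖a p j‖^2) ≤ ∫ θ, Real.sqrt (∑ p, ‖X (a p) θ‖^2) ∂(mu n) := by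
  set v : (Fin n → ℝ) → EuclideanSpace ℝ P := fun θ => WithLp.toLp 2 (fun p => ‖X (a p) θ‖) with hv
  have hvn : ∀ θ, ‖v θ‖ = Real.sqrt (∑ p, ‖X (a p) θ‖^2) := by
    intro θ; rw [EuclideanSpace.norm_eq]; simp [hv]
  have hvi : Integrable v (mu n) := by
    have hc : Continuous v := by
      apply (PiLp.continuous_toLp 2 _).comp
      exact continuous_pi fun p => (continuous_X (a p)).norm
    refine Integrable.of_bound (C := Real.sqrt (∑ p, (∑ j, ‖a p j‖)^2)) hc.aestronglyMeasurable
      (Eventually.of_forall fun θ => ?_)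
    rw [hvn]
    apply Real.sqrt_le_sqrt
    exact Finset.sum_le_sum fun p _ => pow_le_pow_left₀ (norm_nonneg _) (norm_X_le _ _) 2
  have h1 := norm_integral_le_integral_norm v (μ := mu n)
  simp_rw [hvn] at h1
  refine le_trans ?_ h1
  have hcomp : ∀ p, (∫ θ, v θ ∂(mu n)) p = ∫ θ, ‖X (a p) θ‖ ∂(mu n) := by
    intro p
    have := (EuclideanSpace.proj (𝕜 := ℝ) p).integral_comp_comm hvi
    exact this.symm
  rw [EuclideanSpace.norm_eq]
  have hcc := cc_pos
  rw [← Real.sqrt_sq hcc.le, ← Real.sqrt_mul (by positivity), Finset.mul_sum]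
  apply Real.sqrt_le_sqrt
  apply Finset.sum_le_sum
  intro p _
  rw [hcomp, Real.norm_eq_abs, sq_abs]
  have h2 := khinchine (a p)
  have h3 : 0 ≤ ∑ j, ‖a p j‖^2 := Finset.sum_nonneg fun j _ => sq_nonneg _
  calc cc^2 * ∑ j, ‖a p j‖^2 = (cc * Real.sqrt (∑ j, ‖a p j‖^2))^2 := by
        rw [mul_pow, Real.sq_sqrt h3]
    _ ≤ _ := pow_le_pow_left₀ (by positivity) h2 2

lemma step {N n : ℕ} {P : Type*} [Fintype P] (A : Fin N → P → Fin n → ℂ) :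
    ∃ θ : Fin n → ℝ, cc * ∑ k, Real.sqrt (∑ p, ∑ j, ‖A k p j‖^2) ≤
      ∑ k, Real.sqrt (∑ p, ‖∑ j, A k p j * zz (θ j)‖^2) := by
  have hint : ∀ k, Integrable (fun θ => Real.sqrt (∑ p, ‖X (A k p) θ‖^2)) (mu n) := by
    intro k
    have hc : Continuous (fun θ => Real.sqrt (∑ p, ‖X (A k p) θ‖^2)) :=
      Real.continuous_sqrt.comp (continuous_finsetSum _ fun p _ => (continuous_X _).norm.pow 2)
    refine Integrable.of_bound (C := Real.sqrt (∑ p, (∑ j, ‖A k p j‖)^2)) hc.aestronglyMeasurable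
      (Eventually.of_forall fun θ => ?_)
    rw [Real.norm_of_nonneg (Real.sqrt_nonneg _)]
    apply Real.sqrt_le_sqrt
    exact Finset.sum_le_sum fun p _ => pow_le_pow_left₀ (norm_nonneg _) (norm_X_le _ _) 2
  have hs : Integrable (fun θ => ∑ k, Real.sqrt (∑ p, ‖X (A k p) θ‖^2)) (mu n) :=
    integrable_finsetSum _ fun k _ => hint k
  obtain ⟨θ, hθ⟩ := exists_integral_le hs
  refine ⟨θ, le_trans ?_ hθ⟩
  rw [integral_finsetSum _ fun k _ => hint k, Finset.mul_sum]
  exact Finset.sum_le_sum fun k _ => minkowski (A k)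

theorem finite_bound (N : ℕ) : ∀ (d : ℕ) (A : Fin N → (Fin d → Fin N) → ℂ) (M : ℝ)
    (_ : ∀ (θ₀ : Fin N → ℝ) (θ : Fin d → Fin N → ℝ),
      ‖∑ n, ∑ g, A n g * (zz (θ₀ n) * ∏ i, zz (θ i (g i)))‖ ≤ M),
    cc ^ d * ∑ n, Real.sqrt (∑ g, ‖A n g‖^2) ≤ M := by
  intro d
  induction d with
  | zero =>
    intro A M h
    have h1 := h (fun n => -(A n default).arg) default
    simp only [Finset.univ_unique, Finset.sum_singleton, Finset.univ_eq_empty, Finset.prod_empty, mul_one] at h1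
    simp only [pow_zero, one_mul, Finset.univ_unique, Finset.sum_singleton]
    have e : ∀ n, A n default * zz (-(A n default).arg) = (‖A n default‖ : ℂ) := by
      intro n
      have h5 : zz (A n default).arg * zz (-(A n default).arg) = 1 := by
        rw [← zz_add]; simp [zz]
      calc A n default * zz (-(A n default).arg)
          = (‖A n default‖ * zz (A n default).arg) * zz (-(A n default).arg) := by rw [← polar]
        _ = _ := by rw [mul_assoc, h5, mul_one]
    simp_rw [e] at h1
    rw [← Complex.ofReal_sum, Complex.norm_real, Real.norm_of_nonneg (Finset.sum_nonneg fun _ _ => norm_nonneg _)] at h1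
    simp_rw [Real.sqrt_sq (norm_nonneg _)]
    exact h1
  | succ d ih =>
    intro A M h
    obtain ⟨θ', hθ'⟩ := step (fun n (g : Fin d → Fin N) j => A n (Fin.cons j g))
    have re : ∀ {E : Type} [AddCommMonoid E] (f : (Fin (d+1) → Fin N) → E),
        ∑ g, f g = ∑ g : Fin d → Fin N, ∑ j, f (Fin.cons j g) := by
      intro E _ f
      rw [Finset.sum_comm, ← Fintype.sum_prod_type', ← (Fin.consEquiv (fun _ => Fin N)).sum_comp]
      rfl
    have h2 := ih (fun n g => ∑ j, A n (Fin.cons j g) * zz (θ' j)) M (by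
      intro θ₀ θ
      refine le_trans (le_of_eq ?_) (h θ₀ (Fin.cons θ' θ))
      congr 1
      apply Finset.sum_congr rfl
      intro n _
      rw [re]
      apply Finset.sum_congr rfl
      intro g _
      rw [Finset.sum_mul]
      apply Finset.sum_congr rfl
      intro j _
      rw [Fin.prod_univ_succ]
      simp only [Fin.cons_zero, Fin.cons_succ]
      ring)
    refine le_trans ?_ h2
    rw [pow_succ, mul_assoc]
    apply mul_le_mul_of_nonneg_left _ (pow_nonneg cc_pos.le _)
    refine le_trans (le_of_eq ?_) hθ'
    simp_rw [re]

end SK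

namespace SK
open MeasureTheory Set

lemma e_apply (i j : ℕ) : e i j = if j = i then 1 else 0 := by
  have : e i j = (Pi.single i 1 : ℕ → ℂ) j := rfl
  rw [this, Pi.single_apply]

lemma norm_comb (N : ℕ) (θ : Fin N → ℝ) : ‖∑ j : Fin N, zz (θ j) • e j‖ ≤ 1 := by
  rw [← ZeroAtInftyContinuousMap.norm_toBCF_eq_norm]
  rw [BoundedContinuousFunction.norm_le zero_le_one]
  intro x
  have h : (∑ j : Fin N, zz (θ j) • e j : c0) x = ∑ j : Fin N, zz (θ j) * (if x = j then 1 else 0) := by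
    have h1 : ∀ s : Finset (Fin N), (∑ j ∈ s, zz (θ j) • e j : c0) x =
        ∑ j ∈ s, zz (θ j) * (if x = j then 1 else 0) := by
      classical
      intro s
      induction s using Finset.induction_on with
      | empty => simp
      | insert a s ha ih =>
        rw [Finset.sum_insert ha, Finset.sum_insert ha, ZeroAtInftyContinuousMap.add_apply, ih,
          ZeroAtInftyContinuousMap.smul_apply, e_apply, smul_eq_mul]
    exact h1 _
  have h' : (∑ j : Fin N, zz (θ j) • e j : c0).toBCF x = (∑ j : Fin N, zz (θ j) • e j : c0) x := rfl
  rw [h', h]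
  by_cases hx : x < N
  · rw [Finset.sum_eq_single (⟨x, hx⟩ : Fin N)]
    · simp [norm_zz]
    · intro j _ hj
      rw [if_neg, mul_zero]
      intro h; apply hj; ext; exact h.symm
    · simp
  · rw [Finset.sum_eq_zero]
    · simp
    · intro j _
      rw [if_neg, mul_zero]
      intro h; apply hx; rw [h]; exact j.2

lemma cube_bound (d : ℕ) (T : MForm (d+1)) (k : Fin (d+1)) (N : ℕ) :
    cc ^ d * ∑ n : Fin N, Real.sqrt (∑ g : Fin d → Fin N,
      ‖T (fun i => e (k.insertNth (α := fun _ => Fin N) n g i : Fin N))‖^2) ≤ ‖T‖ := by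
  apply finite_bound N d (fun n g => T (fun i => e (k.insertNth (α := fun _ => Fin N) n g i : Fin N))) ‖T‖
  intro θ₀ θ
  set φ : Fin (d+1) → Fin N → ℝ := k.insertNth (α := fun _ => Fin N → ℝ) θ₀ θ with hφ
  have h1 : T (fun i => ∑ j : Fin N, zz (φ i j) • e j) =
      ∑ h : Fin (d+1) → Fin N, (∏ i, zz (φ i (h i))) * T (fun i => e (h i)) := by
    rw [← ContinuousMultilinearMap.coe_coe, MultilinearMap.map_sum]
    apply Finset.sum_congr rfl
    intro h _
    rw [MultilinearMap.map_smul_univ, smul_eq_mul]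
  have h2 : ∑ n, ∑ g : Fin d → Fin N, T (fun i => e (k.insertNth (α := fun _ => Fin N) n g i : Fin N)) *
      (zz (θ₀ n) * ∏ i, zz (θ i (g i))) = T (fun i => ∑ j : Fin N, zz (φ i j) • e j) := by
    rw [h1, ← Fintype.sum_prod_type', ← (Fin.insertNthEquiv (fun _ => Fin N) k).sum_comp]
    apply Finset.sum_congr rfl
    intro p _
    rw [Fin.prod_univ_succAbove _ k]
    simp [hφ]
    ring
  rw [h2]
  refine (T.le_opNorm _).trans ?_
  calc ‖T‖ * ∏ i, ‖∑ j : Fin N, zz (φ i j) • e j‖ ≤ ‖T‖ * 1 := by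
        gcongr
        exact Finset.prod_le_one (fun _ _ => norm_nonneg _) (fun i _ => norm_comb N _)
    _ = _ := mul_one _

/-- the cube of side `N` -/
def cube (d N : ℕ) : Finset (Fin d → ℕ) := Fintype.piFinset (fun _ => Finset.range N)

lemma mem_cube {d N : ℕ} {h : Fin d → ℕ} : h ∈ cube d N ↔ ∀ i, h i < N := by
  simp [cube]

lemma cube_mono (d : ℕ) : Monotone (cube d) := by
  intro a b hab h hh
  rw [mem_cube] at *
  exact fun i => (hh i).trans_le hab

lemma cube_exhaust (d : ℕ) (h : Fin d → ℕ) : ∃ N, h ∈ cube d N := by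
  refine ⟨∑ i, h i + 1, mem_cube.2 fun i => ?_⟩
  have := Finset.single_le_sum (f := h) (fun j _ => Nat.zero_le _) (Finset.mem_univ i)
  omega

lemma sum_cube (d N : ℕ) (F : (Fin d → ℕ) → ℝ) :
    ∑ h ∈ cube d N, F h = ∑ g : Fin d → Fin N, F (fun i => (g i : ℕ)) := by
  symm
  apply Finset.sum_bij (fun (g : Fin d → Fin N) _ => fun i => (g i : ℕ))
  · intro g _; exact mem_cube.2 fun i => (g i).2
  · intro g _ g' _ h; ext i; exact congrFun h i
  · intro h hh
    exact ⟨fun i => ⟨h i, mem_cube.1 hh i⟩, Finset.mem_univ _, rfl⟩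
  · intro g _; rfl

/-- fibre equivalence -/
def fibEquiv (d : ℕ) (k : Fin (d+1)) (n : ℕ) : (Fin d → ℕ) ≃ {g : Fin (d+1) → ℕ // g k = n} where
  toFun h := ⟨k.insertNth (α := fun _ => ℕ) n h, by simp⟩
  invFun g := k.removeNth g.1
  left_inv h := by simp
  right_inv g := by
    obtain ⟨g, rfl⟩ := g
    simp

lemma cube_bound' (d : ℕ) (T : MForm (d+1)) (k : Fin (d+1)) (N : ℕ) :
    ∑ n ∈ Finset.range N, Real.sqrt (∑ h ∈ cube d N,
      ‖T (fun i => e (k.insertNth (α := fun _ => ℕ) n h i))‖^2) ≤ (1/cc)^d * ‖T‖ := by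
  have h := cube_bound d T k N
  have hc : 0 < cc^d := pow_pos cc_pos _
  rw [mul_comm, ← le_div_iff₀ hc] at h
  rw [one_div, inv_pow, mul_comm, ← div_eq_mul_inv]
  refine le_trans (le_of_eq ?_) h
  rw [Finset.sum_range]
  apply Finset.sum_congr rfl
  intro n _
  rw [sum_cube]
  congr 1
  apply Finset.sum_congr rfl
  intro g _
  congr 3
  ext i : 1
  congr 1
  refine Fin.succAboveCases k ?_ (fun j => ?_) i <;> simp

theorem main (d : ℕ) (T : MForm (d+1)) (k : Fin (d+1)) :
    (∑' n : ℕ, (∑' g : {g : Fin (d+1) → ℕ // g k = n},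
        ‖T (fun i => e (g.1 i))‖ ^ 2) ^ ((1 : ℝ)/2)) ≤ (1/cc)^d * ‖T‖ := by
  set f : ℕ → (Fin d → ℕ) → ℝ := fun n h => ‖T (fun i => e (k.insertNth (α := fun _ => ℕ) n h i))‖^2 with hf
  set M := (1/cc)^d * ‖T‖ with hM
  have hf0 : ∀ n h, 0 ≤ f n h := fun n h => by simp only [hf]; positivity
  have hM0 : 0 ≤ M := by have := cc_pos; positivity
  have hre : ∀ n, ∑' g : {g : Fin (d+1) → ℕ // g k = n}, ‖T (fun i => e (g.1 i))‖ ^ 2 = ∑' h, f n h := by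
    intro n
    rw [← (fibEquiv d k n).tsum_eq]; rfl
  simp_rw [hre, ← Real.sqrt_eq_rpow]
  have hcb : ∀ N, ∑ n ∈ Finset.range N, Real.sqrt (∑ h ∈ cube d N, f n h) ≤ M := cube_bound' d T k
  have hcb2 : ∀ N₀ N, N₀ ≤ N → ∑ n ∈ Finset.range N₀, Real.sqrt (∑ h ∈ cube d N, f n h) ≤ M := by
    intro N₀ N h
    refine le_trans ?_ (hcb N)
    apply Finset.sum_le_sum_of_subset_of_nonneg (Finset.range_mono h)
    intro _ _ _; exact Real.sqrt_nonneg _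
  have htend := tendsto_atTop_finset_of_monotone (cube_mono d) (cube_exhaust d)
  have hsum : ∀ n, Summable (f n) := by
    intro n
    apply summable_of_sum_le (c := M^2) (hf0 n)
    intro u
    obtain ⟨N, hN, hN2⟩ := ((htend.eventually_ge_atTop u).and (eventually_gt_atTop n)).exists
    have h1 := hcb N
    have h2 := Finset.single_le_sum (f := fun n => Real.sqrt (∑ h ∈ cube d N, f n h))
      (fun _ _ => Real.sqrt_nonneg _) (Finset.mem_range.2 hN2)
    have h3 : Real.sqrt (∑ h ∈ cube d N, f n h) ≤ M := h2.trans h1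
    have h4 := (Real.sqrt_le_left hM0).1 h3
    refine le_trans ?_ h4
    exact Finset.sum_le_sum_of_subset_of_nonneg hN fun _ _ _ => hf0 n _
  apply Real.tsum_le_of_sum_range_le (fun n => Real.sqrt_nonneg _)
  intro N₀
  have ht : Tendsto (fun N => ∑ n ∈ Finset.range N₀, Real.sqrt (∑ h ∈ cube d N, f n h)) atTop
      (𝓝 (∑ n ∈ Finset.range N₀, Real.sqrt (∑' h, f n h))) := by
    apply tendsto_finsetSum
    intro n _
    exact (Real.continuous_sqrt.tendsto _).comp ((hsum n).hasSum.comp htend)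
  apply le_of_tendsto ht
  filter_upwards [eventually_ge_atTop N₀] with N hN
  exact hcb2 N₀ N hN

end SK

/-- the Khinchine–Steinhaus mixed-norm estimate for `m`-linear forms. -/
theorem stmt1 (m : ℕ) (T : MForm m) (k : Fin m) :
    (∑' n : ℕ, (∑' g : {g : Fin m → ℕ // g k = n},
        ‖T (fun i => e (g.1 i))‖ ^ 2) ^ ((1 : ℝ)/2))
      ≤ (2 / Real.sqrt Real.pi) ^ (m - 1) * ‖T‖ := by
  cases m with
  | zero => exact k.elim0
  | succ d =>
    have h := SK.main d T k
    have h2 : 1 / SK.cc = 2 / Real.sqrt Real.pi := by unfold SK.cc; rw [one_div_div]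
    rw [h2] at h
    exact h
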